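/- arXiv:0911.4321 — 3 statements merged into one kernel-verified Lean document; each statement's English description precedes it below -/
import Mathlib

section
/- Let n ≥ 3, p > 1, q = (2p+n)/n, and C_0 > 0. There exist ε > 0 and C > 0, depending only on n, p, the Sobolev constant C_s of ℝ^n, and C_0, with the following property: for any r > 0, if u is a nonnegative locally Lipschitz function on the ball B_r ⊂ ℝ^n with u ∈ L^p(B_r) satisfying Δu + C_0 u^q ≥ 0 weakly in B_r, and if ∫_{B_r} u^p dx < ε, then sup_{B_{r/2}} u ≤ C r^{-n/p} (∫_{B_r} u^p dx)^{1/p}. -/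
open MeasureTheory Metric Finset Filter Asymptotics
open scoped RealInnerProductSpace

noncomputable section

/-- `pder u i x` is the partial derivative `Dᵢ u (x)` in the `i`-th coordinate direction. -/
def pder {n : ℕ} (u : EuclideanSpace ℝ (Fin n) → ℝ) (i : Fin n)
    (x : EuclideanSpace ℝ (Fin n)) : ℝ :=
  fderiv ℝ u x (EuclideanSpace.single i 1)

/-- The Euclidean Laplacian `Δu = ∑ i, D_i D_i u`. -/
def lap {n : ℕ} (u : EuclideanSpace ℝ (Fin n) → ℝ)
    (x : EuclideanSpace ℝ (Fin n)) : ℝ :=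
  ∑ i : Fin n, pder (pder u i) i x

/-- `|∇V|² = ∑_{l,j} (D_l V_j)²` for a vector-valued map `V`. -/
def gradNormSq {n m : ℕ}
    (V : EuclideanSpace ℝ (Fin n) → EuclideanSpace ℝ (Fin m))
    (x : EuclideanSpace ℝ (Fin n)) : ℝ :=
  ∑ l : Fin n, ∑ j : Fin m, (pder (fun y => V y j) l x) ^ 2

/-- `Δu + F ≥ 0` weakly on `Ω`: for every nonnegative smooth compactly supported
test function `φ` in `Ω`, `∫_Ω (-⟨∇u, ∇φ⟩ + F φ) ≥ 0`. -/
def IsWeakSupersol {n : ℕ} (Ω : Set (EuclideanSpace ℝ (Fin n)))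
    (u F : EuclideanSpace ℝ (Fin n) → ℝ) : Prop :=
  ∀ φ : EuclideanSpace ℝ (Fin n) → ℝ, ContDiff ℝ (⊤ : ℕ∞) φ → HasCompactSupport φ →
    tsupport φ ⊆ interior Ω → (∀ x, 0 ≤ φ x) →
    0 ≤ ∫ x in Ω, (-⟪gradient u x, gradient φ x⟫ + F x * φ x)

/-- `Cs` is a constant for the Sobolev inequality
`(∫ |w|^{2n/(n-2)})^{(n-2)/n} ≤ Cs ∫ |∇w|²` for compactly supported Lipschitz `w` on `ℝⁿ`. -/
def SobolevIneq (n : ℕ) (Cs : ℝ) : Prop :=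
  ∀ w : EuclideanSpace ℝ (Fin n) → ℝ, (∃ K, LipschitzWith K w) → HasCompactSupport w →
    (∫ x, |w x| ^ ((2 * (n : ℝ)) / ((n : ℝ) - 2))) ^ (((n : ℝ) - 2) / (n : ℝ))
      ≤ Cs * ∫ x, ‖gradient w x‖ ^ 2

/-- The smooth radial bump `y ↦ h (1 - |y|²)`, `h = expNegInvGlue`, supported in the unit ball. -/
def radialBump {n : ℕ} (y : EuclideanSpace ℝ (Fin n)) : ℝ :=
  expNegInvGlue (1 - ‖y‖ ^ 2)

/-- The weight `η` with `∇ radialBump y = -η y • y`. -/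
def radialWeight {n : ℕ} (y : EuclideanSpace ℝ (Fin n)) : ℝ :=
  2 * deriv expNegInvGlue (1 - ‖y‖ ^ 2)

lemma contDiff_radialBump {n : ℕ} :
    ContDiff ℝ (⊤ : ℕ∞) (radialBump : EuclideanSpace ℝ (Fin n) → ℝ) :=
  expNegInvGlue.contDiff.comp (contDiff_const.sub (contDiff_norm_sq ℝ))

lemma radialBump_nonneg {n : ℕ} (y : EuclideanSpace ℝ (Fin n)) : 0 ≤ radialBump y :=
  expNegInvGlue.nonneg _

lemma one_sub_norm_sq_nonpos {n : ℕ} {y : EuclideanSpace ℝ (Fin n)}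
    (hy : y ∉ ball (0 : EuclideanSpace ℝ (Fin n)) 1) : 1 - ‖y‖ ^ 2 ≤ 0 := by
  rw [mem_ball_zero_iff, not_lt] at hy
  nlinarith

lemma radialBump_eq_zero {n : ℕ} {y : EuclideanSpace ℝ (Fin n)}
    (hy : y ∉ ball (0 : EuclideanSpace ℝ (Fin n)) 1) : radialBump y = 0 :=
  expNegInvGlue.zero_of_nonpos (one_sub_norm_sq_nonpos hy)

lemma deriv_expNegInvGlue_eq_zero {x : ℝ} (hx : x ≤ 0) : deriv expNegInvGlue x = 0 := by
  have h := expNegInvGlue.hasDerivAt_polynomial_eval_inv_mul 1 x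
  simp only [Polynomial.eval_one, one_mul] at h
  rw [h.deriv, expNegInvGlue.zero_of_nonpos hx, mul_zero]

lemma deriv_expNegInvGlue_one_pos : 0 < deriv expNegInvGlue 1 := by
  have h := expNegInvGlue.hasDerivAt_polynomial_eval_inv_mul 1 1
  simp only [Polynomial.eval_one, one_mul] at h
  rw [h.deriv]
  simpa using expNegInvGlue.pos_of_pos one_pos

lemma radialWeight_eq_zero {n : ℕ} {y : EuclideanSpace ℝ (Fin n)}
    (hy : y ∉ ball (0 : EuclideanSpace ℝ (Fin n)) 1) : radialWeight y = 0 := by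
  rw [radialWeight, deriv_expNegInvGlue_eq_zero (one_sub_norm_sq_nonpos hy), mul_zero]

lemma radialWeight_nonneg {n : ℕ} (y : EuclideanSpace ℝ (Fin n)) : 0 ≤ radialWeight y :=
  mul_nonneg zero_le_two (expNegInvGlue.monotone.deriv_nonneg)

lemma continuous_radialWeight {n : ℕ} :
    Continuous (radialWeight : EuclideanSpace ℝ (Fin n) → ℝ) := by
  have h : Continuous (deriv expNegInvGlue) :=
    (expNegInvGlue.contDiff (n := 1)).continuous_deriv le_rfl
  exact continuous_const.mul (h.comp (by fun_prop))

lemma hasCompactSupport_radialWeight {n : ℕ} :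
    HasCompactSupport (radialWeight : EuclideanSpace ℝ (Fin n) → ℝ) :=
  HasCompactSupport.intro (isCompact_closedBall 0 1) fun _ hy =>
    radialWeight_eq_zero fun h => hy (ball_subset_closedBall h)

lemma hasCompactSupport_radialBump {n : ℕ} :
    HasCompactSupport (radialBump : EuclideanSpace ℝ (Fin n) → ℝ) :=
  HasCompactSupport.intro (isCompact_closedBall 0 1) fun _ hy =>
    radialBump_eq_zero fun h => hy (ball_subset_closedBall h)

lemma integral_radialWeight_pos (n : ℕ) :
    0 < ∫ y : EuclideanSpace ℝ (Fin n), radialWeight y := by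
  refine continuous_radialWeight.integral_pos_of_hasCompactSupport_nonneg_nonzero
    hasCompactSupport_radialWeight radialWeight_nonneg (x := 0) ?_
  have := deriv_expNegInvGlue_one_pos
  simp [radialWeight, this.ne']

lemma hasFDerivAt_radialBump {n : ℕ} (y : EuclideanSpace ℝ (Fin n)) :
    HasFDerivAt radialBump (-(radialWeight y) • innerSL ℝ y) y := by
  have h1 : HasDerivAt expNegInvGlue (deriv expNegInvGlue (1 - ‖y‖ ^ 2)) (1 - ‖y‖ ^ 2) :=
    ((expNegInvGlue.contDiff (n := 1)).differentiable one_ne_zero _).hasDerivAt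
  have h2 : HasFDerivAt (fun y : EuclideanSpace ℝ (Fin n) => 1 - ‖y‖ ^ 2)
      (-(2 • innerSL ℝ y)) y := (hasStrictFDerivAt_norm_sq y).hasFDerivAt.const_sub 1
  refine (h1.comp_hasFDerivAt y h2).congr_fderiv ?_
  ext w
  simp [radialWeight]
  ring

/-- The bump `radialBump` rescaled to `ball x₀ t`. -/
def scaledBump {n : ℕ} (x₀ : EuclideanSpace ℝ (Fin n)) (t : ℝ)
    (x : EuclideanSpace ℝ (Fin n)) : ℝ :=
  radialBump (t⁻¹ • (x - x₀))

lemma contDiff_scaledBump {n : ℕ} (x₀ : EuclideanSpace ℝ (Fin n)) (t : ℝ) :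
    ContDiff ℝ (⊤ : ℕ∞) (scaledBump x₀ t) :=
  contDiff_radialBump.comp (by fun_prop)

lemma scaledBump_eq_zero {n : ℕ} {x₀ x : EuclideanSpace ℝ (Fin n)} {t : ℝ} (ht : 0 < t)
    (hx : x ∉ ball x₀ t) : scaledBump x₀ t x = 0 := by
  refine radialBump_eq_zero fun h => hx ?_
  rw [mem_ball_zero_iff, norm_smul, norm_inv, Real.norm_of_nonneg ht.le,
    inv_mul_lt_iff₀ ht, mul_one] at h
  rwa [mem_ball_iff_norm]

lemma tsupport_scaledBump_subset {n : ℕ} (x₀ : EuclideanSpace ℝ (Fin n)) {t : ℝ} (ht : 0 < t) :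
    tsupport (scaledBump x₀ t) ⊆ closedBall x₀ t :=
  closure_minimal (fun _ hx => ball_subset_closedBall <|
    not_not.1 fun h => hx (scaledBump_eq_zero ht h)) isClosed_closedBall

lemma inner_gradient_scaledBump {n : ℕ} (v : EuclideanSpace ℝ (Fin n) → ℝ)
    (x₀ x : EuclideanSpace ℝ (Fin n)) (t : ℝ) :
    ⟪gradient v x, gradient (scaledBump x₀ t) x⟫ =
      -(t⁻¹ * (fderiv ℝ v x (t⁻¹ • (x - x₀)) * radialWeight (t⁻¹ • (x - x₀)))) := by
  have h2 : HasFDerivAt (fun x : EuclideanSpace ℝ (Fin n) => t⁻¹ • (x - x₀))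
      (t⁻¹ • ContinuousLinearMap.id ℝ _) x := ((hasFDerivAt_id x).sub_const x₀).const_smul t⁻¹
  have h := ((hasFDerivAt_radialBump (t⁻¹ • (x - x₀))).comp x h2).fderiv
  have h' : fderiv ℝ (scaledBump x₀ t) x = _ := h
  rw [real_inner_comm]
  simp only [gradient, h']
  rw [InnerProductSpace.toDual_symm_apply]
  have hv (z : EuclideanSpace ℝ (Fin n)) :
      ⟪z, (InnerProductSpace.toDual ℝ _).symm (fderiv ℝ v x)⟫ = fderiv ℝ v x z := by
    rw [real_inner_comm, InnerProductSpace.toDual_symm_apply]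
  simp only [ContinuousLinearMap.comp_apply, _root_.smul_apply,
    ContinuousLinearMap.id_apply, innerSL_apply_apply, inner_smul_right, hv, smul_eq_mul]
  ring

/-- Differentiation in `t` of the weighted mean of a Lipschitz function over `ball x₀ t`. -/
lemma hasDerivAt_weightedMean {n : ℕ} {v : EuclideanSpace ℝ (Fin n) → ℝ} {K : NNReal}
    (hv : LipschitzWith K v) (x₀ : EuclideanSpace ℝ (Fin n)) {t : ℝ} (ht : 0 < t) :
    Integrable (fun y => fderiv ℝ v (x₀ + t • y) y * radialWeight y) ∧
    HasDerivAt (fun t => ∫ y, v (x₀ + t • y) * radialWeight y)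
      (∫ y, fderiv ℝ v (x₀ + t • y) y * radialWeight y) t := by
  have hw := continuous_radialWeight (n := n)
  have hF (τ : ℝ) : Continuous fun y => v (x₀ + τ • y) * radialWeight y :=
    (hv.continuous.comp (by fun_prop)).mul hw
  refine hasDerivAt_integral_of_dominated_loc_of_lip (s := Set.univ)
    (bound := fun y => K * ‖y‖ * radialWeight y) Filter.univ_mem
    (.of_forall fun τ => (hF τ).aestronglyMeasurable)
    ((hF t).integrable_of_hasCompactSupport hasCompactSupport_radialWeight.mul_left) ?_ ?_ ?_ ?_
  · have h1 : Measurable fun y : EuclideanSpace ℝ (Fin n) => fderiv ℝ v (x₀ + t • y) :=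
      (measurable_fderiv ℝ v).comp (by fun_prop)
    have h2 : Measurable fun y : EuclideanSpace ℝ (Fin n) => fderiv ℝ v (x₀ + t • y) y := by
      have : Continuous fun q : (EuclideanSpace ℝ (Fin n) →L[ℝ] ℝ) × EuclideanSpace ℝ (Fin n) =>
        q.1 q.2 := by fun_prop
      exact this.measurable.comp (h1.prodMk measurable_id)
    exact (h2.mul hw.measurable).aestronglyMeasurable
  · refine .of_forall fun y => LipschitzOnWith.of_dist_le_mul fun a _ b _ => ?_
    have h := hv.dist_le_mul (x₀ + a • y) (x₀ + b • y)
    rw [dist_add_left, dist_eq_norm (a • y), ← sub_smul, norm_smul] at h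
    have hη := radialWeight_nonneg y
    rw [Real.coe_nnabs, abs_of_nonneg (by positivity), Real.dist_eq, ← sub_mul, abs_mul,
      abs_of_nonneg hη, Real.dist_eq]
    rw [Real.dist_eq, Real.norm_eq_abs] at h
    calc _ ≤ (K * (|a - b| * ‖y‖)) * radialWeight y := by gcongr
      _ = _ := by ring
  · have : Continuous fun y : EuclideanSpace ℝ (Fin n) => K * ‖y‖ * radialWeight y := by fun_prop
    exact this.integrable_of_hasCompactSupport hasCompactSupport_radialWeight.mul_left
  · have hlip : LipschitzWith (K * ‖t‖₊) fun y => v (x₀ + t • y) := by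
      refine LipschitzWith.of_dist_le_mul fun a b => ?_
      have h := hv.dist_le_mul (x₀ + t • a) (x₀ + t • b)
      rw [dist_add_left, dist_smul₀] at h
      simpa [mul_assoc] using h
    filter_upwards [hlip.ae_differentiableAt (μ := volume)] with y hy
    have hd : DifferentiableAt ℝ v (x₀ + t • y) := by
      have h1 : DifferentiableAt ℝ (fun x => t⁻¹ • (x - x₀)) (x₀ + t • y) := by fun_prop
      have hy' : DifferentiableAt ℝ (fun y => v (x₀ + t • y)) (t⁻¹ • ((x₀ + t • y) - x₀)) := by
        simpa [smul_smul, ht.ne'] using hy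
      have h2 := hy'.comp (x₀ + t • y) h1
      refine h2.congr_of_eventuallyEq (.of_forall fun x => ?_)
      simp [smul_smul, ht.ne']
    have h3 : HasDerivAt (fun τ : ℝ => x₀ + τ • y) y t := by
      simpa using ((hasDerivAt_id t).smul_const y).const_add x₀
    exact (hd.hasFDerivAt.comp_hasDerivAt t h3).mul_const _

/-- The weak inequality `Δv + f ≥ 0` tested against `scaledBump x₀ t`, in rescaled variables. -/
lemma weightedMean_deriv_ge {n : ℕ} {v f : EuclideanSpace ℝ (Fin n) → ℝ} {K : NNReal}
    (hv : LipschitzWith K v) (hf : Continuous f) {x₀ : EuclideanSpace ℝ (Fin n)} {t Λ : ℝ}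
    (ht : 0 < t) (hfΛ : ∀ x ∈ ball x₀ t, f x ≤ Λ)
    (hweak : 0 ≤ ∫ x, (-⟪gradient v x, gradient (scaledBump x₀ t) x⟫ +
      f x * scaledBump x₀ t x)) :
    -(t * Λ * ∫ y : EuclideanSpace ℝ (Fin n), radialBump y) ≤
      ∫ y, fderiv ℝ v (x₀ + t • y) y * radialWeight y := by
  set H : EuclideanSpace ℝ (Fin n) → ℝ := fun y =>
    t⁻¹ * (fderiv ℝ v (x₀ + t • y) y * radialWeight y) + f (x₀ + t • y) * radialBump y with hH
  have hcongr : ∀ x, -⟪gradient v x, gradient (scaledBump x₀ t) x⟫ + f x * scaledBump x₀ t x =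
      H (t⁻¹ • (x - x₀)) := by
    intro x
    have : x₀ + t • t⁻¹ • (x - x₀) = x := by simp [smul_smul, ht.ne']
    simp only [hH, this, inner_gradient_scaledBump, neg_neg, scaledBump]
  simp_rw [hcongr] at hweak
  rw [integral_sub_right_eq_self (fun x => H (t⁻¹ • x)) x₀, Measure.integral_comp_inv_smul,
    smul_eq_mul] at hweak
  have hpos : 0 < |t ^ Module.finrank ℝ (EuclideanSpace ℝ (Fin n))| := by positivity
  have hH0 : 0 ≤ ∫ y, H y := nonneg_of_mul_nonneg_right hweak hpos
  have hi1 := (hasDerivAt_weightedMean hv x₀ ht).1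
  have hbc := (contDiff_radialBump (n := n)).continuous
  have hi2 : Integrable fun y => f (x₀ + t • y) * radialBump y := by
    have : Continuous fun y => f (x₀ + t • y) * radialBump y :=
      (hf.comp (by fun_prop)).mul hbc
    exact this.integrable_of_hasCompactSupport hasCompactSupport_radialBump.mul_left
  rw [integral_add (hi1.const_mul _) hi2, integral_const_mul] at hH0
  have hle : ∫ y, f (x₀ + t • y) * radialBump y ≤
      Λ * ∫ y : EuclideanSpace ℝ (Fin n), radialBump y := by
    rw [← integral_const_mul]
    refine integral_mono hi2
      ((hbc.integrable_of_hasCompactSupport hasCompactSupport_radialBump).const_mul _) fun y => ?_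
    by_cases hy : y ∈ ball (0 : EuclideanSpace ℝ (Fin n)) 1
    · refine mul_le_mul_of_nonneg_right (hfΛ _ ?_) (radialBump_nonneg y)
      rw [mem_ball_zero_iff] at hy
      rw [mem_ball_iff_norm, add_sub_cancel_left, norm_smul, Real.norm_of_nonneg ht.le]
      exact mul_lt_of_lt_one_right ht hy
    · simp [radialBump_eq_zero hy]
  have h : 0 ≤ t * (t⁻¹ * (∫ y, fderiv ℝ v (x₀ + t • y) y * radialWeight y) +
      Λ * ∫ y : EuclideanSpace ℝ (Fin n), radialBump y) := mul_nonneg ht.le (by linarith)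
  rw [mul_add, mul_inv_cancel_left₀ ht.ne'] at h
  linarith

lemma continuous_weightedMean {n : ℕ} {v : EuclideanSpace ℝ (Fin n) → ℝ} (hv : Continuous v)
    (x₀ : EuclideanSpace ℝ (Fin n)) :
    Continuous fun t : ℝ => ∫ y, v (x₀ + t • y) * radialWeight y := by
  have h : (fun t : ℝ => ∫ y, v (x₀ + t • y) * radialWeight y) = fun t =>
      ∫ y in closedBall (0 : EuclideanSpace ℝ (Fin n)) 1, v (x₀ + t • y) * radialWeight y := by
    funext t
    refine (setIntegral_eq_integral_of_forall_compl_eq_zero fun y hy => ?_).symm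
    rw [radialWeight_eq_zero fun h => hy (ball_subset_closedBall h), mul_zero]
  rw [h]
  refine continuous_parametric_integral_of_continuous ?_ (isCompact_closedBall _ _)
  exact (hv.comp (by fun_prop)).mul (continuous_radialWeight.comp continuous_snd)

/-- Mean value inequality for Lipschitz weak solutions of `Δv + f ≥ 0` with `f ≤ Λ`. -/
lemma weak_mean_value_le {n : ℕ} {v f : EuclideanSpace ℝ (Fin n) → ℝ} {K : NNReal}
    (hv : LipschitzWith K v) (hf : Continuous f) {x₀ : EuclideanSpace ℝ (Fin n)} {s Λ : ℝ}
    (hs : 0 < s) (hfΛ : ∀ x ∈ ball x₀ s, f x ≤ Λ)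
    (hweak : ∀ t, 0 < t → t < s →
      0 ≤ ∫ x, (-⟪gradient v x, gradient (scaledBump x₀ t) x⟫ + f x * scaledBump x₀ t x)) :
    v x₀ * ∫ y : EuclideanSpace ℝ (Fin n), radialWeight y ≤
      (∫ y, v (x₀ + s • y) * radialWeight y) +
        Λ * s ^ 2 / 2 * ∫ y : EuclideanSpace ℝ (Fin n), radialBump y := by
  set P := ∫ y : EuclideanSpace ℝ (Fin n), radialBump y
  have hderiv : ∀ t : ℝ, 0 < t → HasDerivAt
      (fun t => (∫ y, v (x₀ + t • y) * radialWeight y) + Λ * t ^ 2 / 2 * P)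
      ((∫ y, fderiv ℝ v (x₀ + t • y) y * radialWeight y) + t * Λ * P) t := by
    intro t ht
    refine (hasDerivAt_weightedMean hv x₀ ht).2.add ?_
    have := (((hasDerivAt_pow 2 t).const_mul Λ).div_const 2).mul_const P
    refine this.congr_deriv ?_
    push_cast
    ring
  have hmono : MonotoneOn
      (fun t => (∫ y, v (x₀ + t • y) * radialWeight y) + Λ * t ^ 2 / 2 * P) (Set.Icc 0 s) := by
    refine monotoneOn_of_deriv_nonneg (convex_Icc 0 s) ?_ ?_ ?_
    · have := continuous_weightedMean hv.continuous x₀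
      exact Continuous.continuousOn (by fun_prop)
    · intro t ht
      rw [interior_Icc] at ht
      exact (hderiv t ht.1).differentiableAt.differentiableWithinAt
    · intro t ht
      rw [interior_Icc] at ht
      rw [(hderiv t ht.1).deriv]
      have := weightedMean_deriv_ge hv hf ht.1
        (fun x hx => hfΛ x (ball_subset_ball ht.2.le hx)) (hweak t ht.1 ht.2)
      linarith
  have h := hmono (Set.left_mem_Icc.2 hs.le) (Set.right_mem_Icc.2 hs.le) hs.le
  simpa [integral_const_mul] using h

/-- Hölder bound for the weighted mean of a nonnegative continuous function. -/
lemma weightedMean_le {n : ℕ} {p q : ℝ} (hpq : p.HolderConjugate q)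
    {v : EuclideanSpace ℝ (Fin n) → ℝ} (hv : Continuous v) {x₀ : EuclideanSpace ℝ (Fin n)}
    {s : ℝ} (hs : 0 < s) (hv0 : ∀ x ∈ ball x₀ s, 0 ≤ v x) :
    ∫ y, v (x₀ + s • y) * radialWeight y ≤
      s ^ (-(n : ℝ) / p) * (∫ x in ball x₀ s, v x ^ p) ^ (1 / p) *
        (∫ y in ball (0 : EuclideanSpace ℝ (Fin n)) 1, radialWeight y ^ q) ^ (1 / q) := by
  have hmem (y : EuclideanSpace ℝ (Fin n)) :
      x₀ + s • y ∈ ball x₀ s ↔ y ∈ ball (0 : EuclideanSpace ℝ (Fin n)) 1 := by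
    rw [mem_ball_iff_norm, add_sub_cancel_left, norm_smul, Real.norm_of_nonneg hs.le,
      mul_lt_iff_lt_one_right hs, mem_ball_zero_iff]
  have hmemLp {f : EuclideanSpace ℝ (Fin n) → ℝ} (hf : Continuous f) (a : ENNReal) :
      MemLp f a (volume.restrict (ball (0 : EuclideanSpace ℝ (Fin n)) 1)) := by
    have : IsFiniteMeasure (volume.restrict (ball (0 : EuclideanSpace ℝ (Fin n)) 1)) :=
      ⟨by simpa using measure_ball_lt_top⟩
    obtain ⟨C, hC⟩ := (isCompact_closedBall (0 : EuclideanSpace ℝ (Fin n)) 1)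
      |>.exists_bound_of_continuousOn hf.continuousOn
    exact MemLp.of_bound hf.aestronglyMeasurable C <|
      (ae_restrict_mem measurableSet_ball).mono fun y hy => hC y (ball_subset_closedBall hy)
  have hp := integral_mul_le_Lp_mul_Lq_of_nonneg hpq
    (μ := volume.restrict (ball (0 : EuclideanSpace ℝ (Fin n)) 1))
    (f := fun y => v (x₀ + s • y)) (g := radialWeight)
    ((ae_restrict_mem measurableSet_ball).mono fun y hy => hv0 _ ((hmem y).2 hy))
    (.of_forall radialWeight_nonneg)
    (hmemLp (hv.comp (by fun_prop)) _) (hmemLp continuous_radialWeight _)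
  rw [setIntegral_eq_integral_of_forall_compl_eq_zero fun y hy => by
    rw [radialWeight_eq_zero hy, mul_zero]] at hp
  refine hp.trans_eq ?_
  congr 1
  have hscale : ∫ y in ball (0 : EuclideanSpace ℝ (Fin n)) 1, v (x₀ + s • y) ^ p =
      (s ^ n)⁻¹ * ∫ x in ball x₀ s, v x ^ p := by
    rw [← integral_indicator measurableSet_ball, ← integral_indicator measurableSet_ball]
    set G := (ball x₀ s).indicator fun x => v x ^ p with hGdef
    have hG : (ball (0 : EuclideanSpace ℝ (Fin n)) 1).indicator
        (fun y => v (x₀ + s • y) ^ p) = fun y => G (x₀ + s • y) := by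
      funext y
      by_cases hy : y ∈ ball (0 : EuclideanSpace ℝ (Fin n)) 1
      · rw [hGdef, Set.indicator_of_mem hy, Set.indicator_of_mem ((hmem y).2 hy)]
      · rw [hGdef, Set.indicator_of_notMem hy,
          Set.indicator_of_notMem (fun h => hy ((hmem y).1 h))]
    rw [hG, Measure.integral_comp_smul_of_nonneg volume (fun y => G (x₀ + y)) s (hR := hs.le),
      integral_add_left_eq_self, finrank_euclideanSpace_fin, smul_eq_mul]
  have hI : 0 ≤ ∫ x in ball x₀ s, v x ^ p :=
    setIntegral_nonneg measurableSet_ball fun x hx => Real.rpow_nonneg (hv0 x hx) p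
  rw [hscale, Real.mul_rpow (by positivity) hI]
  congr 1
  rw [← Real.rpow_natCast, ← Real.rpow_neg hs.le, ← Real.rpow_mul hs.le]
  congr 1
  ring

/-- Local estimate for locally Lipschitz weak solutions of `Δu + C₀ u^q ≥ 0` on `ball 0 r`, on a
ball `ball x₀ s` where `u ≤ M`. -/
lemma IsWeakSupersol.mean_value_le {n : ℕ} {p p' q C0 r σ s M : ℝ} (hpp' : p.HolderConjugate p')
    (hq : 0 ≤ q) (hC0 : 0 ≤ C0) {u : EuclideanSpace ℝ (Fin n) → ℝ}
    (hu0 : ∀ x ∈ ball (0 : EuclideanSpace ℝ (Fin n)) r, 0 ≤ u x)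
    (hlip : LocallyLipschitzOn (ball 0 r) u)
    (hint : IntegrableOn (fun x => u x ^ p) (ball (0 : EuclideanSpace ℝ (Fin n)) r))
    (hweak : IsWeakSupersol (ball 0 r) u (fun x => C0 * u x ^ q))
    {x₀ : EuclideanSpace ℝ (Fin n)} (hσr : σ < r) (hs : 0 < s)
    (hsub : ball x₀ s ⊆ ball (0 : EuclideanSpace ℝ (Fin n)) σ) (hM : ∀ x ∈ ball x₀ s, u x ≤ M) :
    u x₀ * ∫ y : EuclideanSpace ℝ (Fin n), radialWeight y ≤
      s ^ (-(n : ℝ) / p) *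
        (∫ x in ball (0 : EuclideanSpace ℝ (Fin n)) r, u x ^ p) ^ (1 / p) *
        (∫ y in ball (0 : EuclideanSpace ℝ (Fin n)) 1, radialWeight y ^ p') ^ (1 / p') +
      C0 * M ^ q * s ^ 2 / 2 * ∫ y : EuclideanSpace ℝ (Fin n), radialBump y := by
  have hσ : ball (0 : EuclideanSpace ℝ (Fin n)) σ ⊆ ball 0 r := ball_subset_ball hσr.le
  obtain ⟨K, hK⟩ := (hlip.mono (closedBall_subset_ball hσr)).exists_lipschitzOnWith_of_compact
    (isCompact_closedBall 0 σ)
  obtain ⟨v, hv, huv⟩ := (hK.mono ball_subset_closedBall).extend_real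
  have hx₀ : x₀ ∈ ball (0 : EuclideanSpace ℝ (Fin n)) σ := hsub (mem_ball_self hs)
  have hf : Continuous fun x => C0 * v x ^ q :=
    continuous_const.mul (hv.continuous.rpow_const fun _ => Or.inr hq)
  have hmean := weak_mean_value_le hv hf (x₀ := x₀) (Λ := C0 * M ^ q) hs ?_ ?_
  · have hhol := weightedMean_le hpp' hv.continuous (x₀ := x₀) hs fun x hx => by
      rw [← huv (hsub hx)]
      exact hu0 x (hσ (hsub hx))
    have hle : ∫ x in ball x₀ s, v x ^ p ≤
        ∫ x in ball (0 : EuclideanSpace ℝ (Fin n)) r, u x ^ p := by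
      rw [setIntegral_congr_fun (g := fun x => u x ^ p) measurableSet_ball
        fun x hx => by simp only [huv (hsub hx)]]
      refine setIntegral_mono_set hint ?_ (LE.le.eventuallyLE (hsub.trans hσ))
      exact (ae_restrict_mem measurableSet_ball).mono fun x hx => Real.rpow_nonneg (hu0 x hx) p
    have hnn : 0 ≤ ∫ x in ball x₀ s, v x ^ p := by
      refine setIntegral_nonneg measurableSet_ball fun x hx => Real.rpow_nonneg ?_ p
      rw [← huv (hsub hx)]
      exact hu0 x (hσ (hsub hx))
    have hH : 0 ≤ ∫ y in ball (0 : EuclideanSpace ℝ (Fin n)) 1, radialWeight y ^ p' :=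
      setIntegral_nonneg measurableSet_ball fun y _ => Real.rpow_nonneg (radialWeight_nonneg y) _
    rw [huv hx₀]
    refine hmean.trans (add_le_add_left (hhol.trans ?_) _)
    have hp := hpp'.pos
    gcongr
  · intro x hx
    have h0 := hu0 x (hσ (hsub hx))
    have hMx := hM x hx
    rw [huv (hsub hx)] at h0 hMx
    gcongr
  · intro t ht hts
    have hsupp : tsupport (scaledBump x₀ t) ⊆ ball 0 σ :=
      (tsupport_scaledBump_subset x₀ ht).trans ((closedBall_subset_ball hts).trans hsub)
    have h := hweak (scaledBump x₀ t) (contDiff_scaledBump x₀ t)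
      ((isCompact_closedBall x₀ t).of_isClosed_subset (isClosed_tsupport _)
        (tsupport_scaledBump_subset x₀ ht))
      (by rw [isOpen_ball.interior_eq]; exact hsupp.trans hσ) fun x => radialBump_nonneg _
    have hzero : ∀ x ∉ ball (0 : EuclideanSpace ℝ (Fin n)) σ,
        scaledBump x₀ t x = 0 ∧ gradient (scaledBump x₀ t) x = 0 := by
      intro x hx
      have hx' : x ∉ tsupport (scaledBump x₀ t) := fun h => hx (hsupp h)
      refine ⟨image_eq_zero_of_notMem_tsupport hx', ?_⟩
      have h0 : fderiv ℝ (scaledBump x₀ t) x = 0 := by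
        have := (notMem_tsupport_iff_eventuallyEq.1 hx').fderiv_eq (𝕜 := ℝ)
        rw [this]
        exact fderiv_const_apply (0 : ℝ)
      simp [gradient, h0]
    rw [setIntegral_eq_integral_of_forall_compl_eq_zero fun x hx => by
      obtain ⟨h1, h2⟩ := hzero x fun h => hx (hσ h)
      simp [h1, h2]] at h
    refine h.trans_eq (integral_congr_ae (.of_forall fun x => ?_))
    by_cases hx : x ∈ ball (0 : EuclideanSpace ℝ (Fin n)) σ
    · have hev : u =ᶠ[nhds x] v :=
        Filter.eventuallyEq_of_mem (isOpen_ball.mem_nhds hx) huv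
      simp only [gradient, hev.fderiv_eq, huv hx]
    · obtain ⟨h1, h2⟩ := hzero x hx
      simp [h1, h2]

/-- **Lemma 1 (Moser iteration sup bound).** Let `p > 1`, `q = (2p+n)/n`, `C₀ > 0`.
There exist `ε > 0` and `C > 0` (depending only on `n, p, Cs, C₀`) such that any
nonnegative locally Lipschitz `u ∈ Lᵖ(B_r)` with `Δu + C₀ u^q ≥ 0` weakly in `B_r`
and `∫_{B_r} uᵖ < ε` satisfies `sup_{B_{r/2}} u ≤ C r^{-n/p} ‖u‖_{Lᵖ(B_r)}`. -/
theorem moser_sup_bound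
    (n : ℕ) (hn : 3 ≤ n) (p q C0 Cs : ℝ) (hp : 1 < p) (hq : q = (2 * p + n) / n)
    (hC0 : 0 < C0) (hCs : SobolevIneq n Cs) :
    ∃ ε > (0 : ℝ), ∃ C > (0 : ℝ), ∀ r : ℝ, 0 < r →
      ∀ u : EuclideanSpace ℝ (Fin n) → ℝ,
      (∀ x ∈ ball (0 : EuclideanSpace ℝ (Fin n)) r, 0 ≤ u x) →
      LocallyLipschitzOn (ball 0 r) u →
      IntegrableOn (fun x => u x ^ p) (ball (0 : EuclideanSpace ℝ (Fin n)) r) →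
      IsWeakSupersol (ball 0 r) u (fun x => C0 * u x ^ q) →
      (∫ x in ball (0 : EuclideanSpace ℝ (Fin n)) r, u x ^ p) < ε →
      ∀ x ∈ ball (0 : EuclideanSpace ℝ (Fin n)) (r / 2),
        u x ≤ C * r ^ (-(n : ℝ) / p) *
          (∫ y in ball (0 : EuclideanSpace ℝ (Fin n)) r, u y ^ p) ^ (1 / p) := by
  have hn0 : (0 : ℝ) < n := by exact_mod_cast (by lia : 0 < n)
  have hp0 : 0 < p := one_pos.trans hp
  set a : ℝ := n / p with ha
  have ha0 : 0 < a := div_pos hn0 hp0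
  have hqa : q = 1 + 2 / a := by
    rw [hq, ha]
    field_simp
    ring
  have hq0 : 0 ≤ q := by rw [hqa]; positivity
  have hpp' := Real.HolderConjugate.conjExponent hp
  set c₀ := ∫ y : EuclideanSpace ℝ (Fin n), radialWeight y
  set P := ∫ y : EuclideanSpace ℝ (Fin n), radialBump y
  set H := (∫ y in ball (0 : EuclideanSpace ℝ (Fin n)) 1,
    radialWeight y ^ p.conjExponent) ^ (1 / p.conjExponent)
  have hc₀ : 0 < c₀ := integral_radialWeight_pos n
  have hP : 0 ≤ P := integral_nonneg radialBump_nonneg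
  have hH : 0 ≤ H := Real.rpow_nonneg (setIntegral_nonneg measurableSet_ball
    fun y _ => Real.rpow_nonneg (radialWeight_nonneg y) _) _
  set D := 2 * H / c₀ + 1 with hD
  have hD0 : 0 < D := by positivity
  set L := C0 * (2 ^ a) ^ q * P + 1 with hL
  have hL0 : 0 < L := by positivity
  set c₁ := √(c₀ / L) with hc₁
  have hc₁0 : 0 < c₁ := Real.sqrt_pos.2 (by positivity)
  have hc₁L : C0 * (2 ^ a) ^ q * P * c₁ ^ 2 ≤ c₀ := by
    rw [hc₁, Real.sq_sqrt (by positivity), ← mul_div_assoc, div_le_iff₀ hL0, mul_comm]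
    exact mul_le_mul_of_nonneg_left (by linarith) hc₀.le
  refine ⟨(c₁ ^ a / D) ^ p, by positivity, 8 ^ a * D, by positivity, ?_⟩
  intro r hr u hu0 hlip hint hweak hε x hx
  have hI : 0 ≤ ∫ y in ball (0 : EuclideanSpace ℝ (Fin n)) r, u y ^ p :=
    setIntegral_nonneg measurableSet_ball fun y hy => Real.rpow_nonneg (hu0 y hy) p
  have hmv := fun (x₀ : EuclideanSpace ℝ (Fin n)) (s M : ℝ) =>
    hweak.mean_value_le (σ := 3 * r / 4) (s := s) (M := M) (x₀ := x₀) hpp' hq0 hC0.le hu0 hlip hint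
      (by linarith)
  set N := (∫ y in ball (0 : EuclideanSpace ℝ (Fin n)) r, u y ^ p) ^ (1 / p) with hN
  have hN0 : 0 ≤ N := Real.rpow_nonneg hI _
  have hNε : N < c₁ ^ a / D := by
    have h := Real.rpow_lt_rpow hI hε (one_div_pos.2 hp0)
    rwa [← Real.rpow_mul (by positivity), mul_one_div_cancel hp0.ne', Real.rpow_one] at h
  rw [neg_div, ← ha] at hmv ⊢
  set σ := 3 * r / 4 with hσ
  have hσr : σ < r := by linarith
  have hσ0 : 0 ≤ σ := by linarith
  set F : EuclideanSpace ℝ (Fin n) → ℝ := fun y => (σ - ‖y‖) ^ a * u y with hF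
  obtain ⟨x₀, hx₀, hmax⟩ := (isCompact_closedBall (0 : EuclideanSpace ℝ (Fin n)) σ)
    |>.exists_isMaxOn ⟨0, mem_closedBall_self hσ0⟩ (f := F) (by
      have h1 : Continuous fun y : EuclideanSpace ℝ (Fin n) => (σ - ‖y‖) ^ a :=
        (continuous_const.sub continuous_norm).rpow_const fun _ => Or.inr ha0.le
      exact h1.continuousOn.mul (hlip.continuousOn.mono (closedBall_subset_ball hσr)))
  have hu₀ : 0 ≤ u x₀ := hu0 x₀ (closedBall_subset_ball hσr hx₀)
  have hFx : (r / 4) ^ a * u x ≤ F x₀ := by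
    rw [mem_ball_zero_iff] at hx
    have hxσ : x ∈ closedBall (0 : EuclideanSpace ℝ (Fin n)) σ := by
      rw [mem_closedBall_zero_iff]
      linarith
    have := hu0 x (closedBall_subset_ball hσr hxσ)
    refine le_trans ?_ (hmax hxσ)
    simp only [hF]
    gcongr
    linarith
  have key : F x₀ ≤ 2 ^ a * (D * N) := by
    rw [mem_closedBall_zero_iff] at hx₀
    rcases hx₀.eq_or_lt with h | hlt
    · simp only [hF, h, sub_self, Real.zero_rpow ha0.ne', zero_mul]
      positivity
    rcases hu₀.eq_or_lt with h | hA
    · simp only [hF, ← h, mul_zero]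
      positivity
    set A := u x₀ with hAdef
    set ρ := (σ - ‖x₀‖) / 2 with hρ
    have hρ0 : 0 < ρ := by linarith
    have hF₀ : F x₀ = 2 ^ a * (A * ρ ^ a) := by
      have : σ - ‖x₀‖ = 2 * ρ := by rw [hρ]; ring
      simp only [hF, this, Real.mul_rpow zero_le_two hρ0.le]
      ring
    have hnorm : ∀ y ∈ ball x₀ ρ, ρ ≤ σ - ‖y‖ := fun y hy => by
      have := norm_le_norm_add_norm_sub' y x₀
      rw [mem_ball_iff_norm] at hy
      linarith
    have hsub : ball x₀ ρ ⊆ ball (0 : EuclideanSpace ℝ (Fin n)) σ := fun y hy => by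
      rw [mem_ball_zero_iff]
      linarith [hnorm y hy]
    have hM : ∀ y ∈ ball x₀ ρ, u y ≤ 2 ^ a * A := by
      intro y hy
      have h1 : F y ≤ F x₀ := hmax (ball_subset_closedBall (hsub hy))
      have h0 : 0 ≤ u y := hu0 y (ball_subset_ball hσr.le (hsub hy))
      have h2 : ρ ^ a * u y ≤ F y :=
        mul_le_mul_of_nonneg_right (Real.rpow_le_rpow hρ0.le (hnorm y hy) ha0.le) h0
      have h3 : ρ ^ a * u y ≤ ρ ^ a * (2 ^ a * A) := by linarith
      exact le_of_mul_le_mul_left h3 (by positivity)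
    set τ := c₁ * A ^ (-(1 / a)) with hτ
    have hτ0 : 0 < τ := by positivity
    have hAτ : A ^ q * τ ^ 2 = A * c₁ ^ 2 := by
      rw [hτ, mul_pow, ← Real.rpow_natCast (A ^ (-(1 / a))), ← Real.rpow_mul hA.le,
        mul_left_comm, ← Real.rpow_add hA, hqa]
      have : 1 + 2 / a + -(1 / a) * ((2 : ℕ) : ℝ) = 1 := by push_cast; ring
      rw [this, Real.rpow_one, mul_comm]
    have hbound : ∀ s, 0 < s → s ≤ ρ → s ≤ τ → A ≤ s ^ (-a) * (D * N) := by
      intro s hs hsρ hsτ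
      have h := hmv x₀ s (2 ^ a * A) hs ((ball_subset_ball hsρ).trans hsub)
        fun y hy => hM y (ball_subset_ball hsρ hy)
      have h2 : A ^ q * s ^ 2 ≤ A * c₁ ^ 2 := by
        rw [← hAτ]
        gcongr
      have h3 : C0 * (2 ^ a * A) ^ q * s ^ 2 / 2 * P ≤ A * c₀ / 2 := by
        rw [Real.mul_rpow (by positivity) hA.le]
        calc _ = (C0 * (2 ^ a) ^ q * P) * (A ^ q * s ^ 2) / 2 := by ring
          _ ≤ (C0 * (2 ^ a) ^ q * P) * (A * c₁ ^ 2) / 2 := by gcongr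
          _ = A * (C0 * (2 ^ a) ^ q * P * c₁ ^ 2) / 2 := by ring
          _ ≤ A * c₀ / 2 := by gcongr
      have h4 : A * c₀ ≤ 2 * (s ^ (-a) * N * H) := by linarith
      have h5 : 0 ≤ s ^ (-a) * N := by positivity
      have h6 : A ≤ s ^ (-a) * N * (2 * H / c₀) := by
        rw [← mul_div_assoc, le_div_iff₀ hc₀]
        linarith
      rw [hD]
      linarith
    rw [hF₀]
    refine mul_le_mul_of_nonneg_left ?_ (by positivity)
    rcases le_total ρ τ with hle | hle
    · have h := hbound ρ hρ0 le_rfl hle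
      rwa [Real.rpow_neg hρ0.le, inv_mul_eq_div, le_div_iff₀ (by positivity)] at h
    · exfalso
      have h := hbound τ hτ0 hle le_rfl
      have hτa : τ ^ (-a) = (c₁ ^ a)⁻¹ * A := by
        rw [hτ, Real.mul_rpow hc₁0.le (by positivity), Real.rpow_neg hc₁0.le,
          ← Real.rpow_mul hA.le]
        have : -(1 / a) * -a = 1 := by field_simp
        rw [this, Real.rpow_one]
      have h1 : D * N < c₁ ^ a := by
        rw [lt_div_iff₀ hD0] at hNε
        linarith
      have h2 : (c₁ ^ a)⁻¹ * (D * N) < 1 := by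
        rw [inv_mul_lt_iff₀ (by positivity)]
        linarith
      rw [hτa] at h
      nlinarith
  have h := hFx.trans key
  have h8 : (8 : ℝ) ^ a = 2 ^ a * 4 ^ a := by
    rw [← Real.mul_rpow zero_le_two zero_le_four]
    norm_num
  rw [Real.div_rpow hr.le zero_le_four, div_mul_eq_mul_div, div_le_iff₀ (by positivity)] at h
  rw [Real.rpow_neg hr.le, h8, mul_right_comm, ← div_eq_mul_inv, le_div_iff₀ (by positivity)]
  linarith
end
end

section
/- Let n ≥ 3, p > n/(n-2), q = (2p+n)/n, and C_0 > 0. There exists ε > 0 with the following property: if r > 0 and u is a nonnegative locally Lipschitz function on ℝ^n \ B_r with u ∈ L^p(ℝ^n \ B_r) satisfying Δu + C_0 u^q ≥ 0 weakly in ℝ^n \ B_r, and ∫_{ℝ^n \ B_r} u^p dx < ε, then for every λ < n-2 we have u(x) = O(|x|^{-λ}) as |x| → ∞, i.e. there exist constants C_λ and R_λ with u(x) ≤ C_λ |x|^{-λ} for all |x| ≥ R_λ. -/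
open MeasureTheory Metric Finset Filter Asymptotics
open scoped RealInnerProductSpace

noncomputable section

/-- The smooth radial profile `z ↦ exp (-1 / (1 - z))`, vanishing for `z ≥ 1`. -/
def prof (z : ℝ) : ℝ := expNegInvGlue (1 - z)

/-- The first derivative of `prof`. -/
def prof' (z : ℝ) : ℝ := deriv prof z

/-- The second derivative of `prof`. -/
def prof'' (z : ℝ) : ℝ := deriv prof' z

lemma contDiff_prof {k : ℕ∞} : ContDiff ℝ k prof :=
  expNegInvGlue.contDiff.comp (contDiff_const.sub contDiff_id)

lemma contDiff_prof' {k : ℕ} : ContDiff ℝ k prof' := by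
  have h : ContDiff ℝ ((k + 1 : ℕ) : ℕ∞) prof := contDiff_prof
  have h2 : ContDiff ℝ ((k : WithTop ℕ∞) + 1) prof := by exact_mod_cast h
  exact (contDiff_succ_iff_deriv.1 h2).2.2

lemma continuous_prof' : Continuous prof' := (contDiff_prof' (k := 0)).continuous

lemma continuous_prof'' : Continuous prof'' :=
  (contDiff_prof' (k := 1)).continuous_deriv (by norm_num)

lemma hasDerivAt_prof (z : ℝ) : HasDerivAt prof (prof' z) z :=
  ((contDiff_prof (k := 1)).differentiable (by norm_num) z).hasDerivAt

lemma hasDerivAt_prof' (z : ℝ) : HasDerivAt prof' (prof'' z) z :=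
  ((contDiff_prof' (k := 1)).differentiable (by norm_num) z).hasDerivAt

lemma prof_nonneg (z : ℝ) : 0 ≤ prof z := expNegInvGlue.nonneg _

lemma prof_eq_zero {z : ℝ} (hz : 1 ≤ z) : prof z = 0 :=
  expNegInvGlue.zero_of_nonpos (by linarith)

lemma prof'_eq (z : ℝ) : prof' z = -((1 - z)⁻¹ ^ 2 * expNegInvGlue (1 - z)) := by
  have h := expNegInvGlue.hasDerivAt_polynomial_eval_inv_mul 1 (1 - z)
  simp only [Polynomial.eval_one, one_mul, Polynomial.derivative_one, sub_zero, mul_one,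
    Polynomial.eval_pow, Polynomial.eval_X] at h
  have h2 := h.comp z ((hasDerivAt_id z).const_sub 1)
  have := (hasDerivAt_prof z).unique h2
  rw [this]; ring

lemma prof'_nonpos (z : ℝ) : prof' z ≤ 0 := by
  rw [prof'_eq]
  have := expNegInvGlue.nonneg (1 - z)
  have : 0 ≤ (1 - z)⁻¹ ^ 2 * expNegInvGlue (1 - z) := by positivity
  linarith

lemma prof'_neg {z : ℝ} (hz : z < 1) : prof' z < 0 := by
  rw [prof'_eq]
  have := expNegInvGlue.pos_of_pos (x := 1 - z) (by linarith)
  have h1 : 0 < 1 - z := by linarith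
  have : 0 < (1 - z)⁻¹ ^ 2 * expNegInvGlue (1 - z) := by positivity
  linarith

lemma prof'_eq_zero {z : ℝ} (hz : 1 ≤ z) : prof' z = 0 := by
  rw [prof'_eq, expNegInvGlue.zero_of_nonpos (by linarith)]; simp

lemma prof''_eq_zero {z : ℝ} (hz : 1 < z) : prof'' z = 0 := by
  have : prof' =ᶠ[nhds z] fun _ => 0 := by
    filter_upwards [lt_mem_nhds hz] with y hy using prof'_eq_zero hy.le
  rw [prof'', this.deriv_eq]; simp

section Kernel

variable {n : ℕ}

/-- The nonnegative radial kernel `-2 prof' (‖y‖²)`, supported in the closed unit ball. -/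
def mollKer (y : EuclideanSpace ℝ (Fin n)) : ℝ := -2 * prof' (‖y‖ ^ 2)

lemma continuous_mollKer : Continuous (mollKer (n := n)) :=
  continuous_const.mul (continuous_prof'.comp (continuous_norm.pow 2))

lemma mollKer_nonneg (y : EuclideanSpace ℝ (Fin n)) : 0 ≤ mollKer y := by
  have := prof'_nonpos (‖y‖ ^ 2)
  simp only [mollKer]; linarith

lemma mollKer_eq_zero {y : EuclideanSpace ℝ (Fin n)} (hy : 1 ≤ ‖y‖) : mollKer y = 0 := by
  simp [mollKer, prof'_eq_zero (one_le_pow₀ hy : 1 ≤ ‖y‖ ^ 2)]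

lemma mollKer_pos {y : EuclideanSpace ℝ (Fin n)} (hy : ‖y‖ < 1) : 0 < mollKer y := by
  have : ‖y‖ ^ 2 < 1 := by nlinarith [norm_nonneg y]
  have := prof'_neg this
  simp only [mollKer]; linarith

lemma hasCompactSupport_mollKer : HasCompactSupport (mollKer (n := n)) := by
  refine HasCompactSupport.intro (isCompact_closedBall 0 1) fun y hy => mollKer_eq_zero ?_
  simp at hy; exact hy.le

lemma exists_mollKer_le : ∃ B : ℝ, 0 < B ∧ ∀ y : EuclideanSpace ℝ (Fin n), mollKer y ≤ B := by
  obtain ⟨C, hC⟩ := hasCompactSupport_mollKer.exists_bound_of_continuous (continuous_mollKer (n := n))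
  exact ⟨max C 1, by positivity, fun y => (le_abs_self _).trans ((hC y).trans (le_max_left _ _))⟩

lemma integral_mollKer_pos : 0 < ∫ y : EuclideanSpace ℝ (Fin n), mollKer y :=
  continuous_mollKer.integral_pos_of_hasCompactSupport_nonneg_nonzero hasCompactSupport_mollKer
    mollKer_nonneg (x := 0) (mollKer_pos (by simp)).ne'

lemma integral_norm_sq_mul_mollKer_pos (hn : 0 < n) :
    0 < ∫ y : EuclideanSpace ℝ (Fin n), ‖y‖ ^ 2 * mollKer y := by
  refine Continuous.integral_pos_of_hasCompactSupport_nonneg_nonzero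
    ((continuous_norm.pow 2).mul continuous_mollKer) hasCompactSupport_mollKer.mul_left
    (fun y => mul_nonneg (by positivity) (mollKer_nonneg y))
    (x := EuclideanSpace.single ⟨0, hn⟩ (1 / 2)) ?_
  have h : ‖(EuclideanSpace.single ⟨0, hn⟩ (1 / 2) : EuclideanSpace ℝ (Fin n))‖ = 1 / 2 := by
    simp
  have := mollKer_pos (y := (EuclideanSpace.single ⟨0, hn⟩ (1 / 2) : EuclideanSpace ℝ (Fin n)))
    (by rw [h]; norm_num)
  rw [h]; positivity

end Kernel

section Calculus

variable {n : ℕ}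

lemma hasFDerivAt_const_mul_norm_sub_sq (c : ℝ) (a x : EuclideanSpace ℝ (Fin n)) :
    HasFDerivAt (fun y => c * ‖y - a‖ ^ 2) (c • (2 • innerSL ℝ (x - a))) x := by
  have h : HasFDerivAt (fun y => c * ‖y - a‖ ^ 2)
      (c • (2 • (innerSL ℝ (x - a)).comp (ContinuousLinearMap.id ℝ _))) x :=
    ((hasFDerivAt_id x).sub_const a).norm_sq.const_mul c
  rwa [ContinuousLinearMap.comp_id] at h

lemma pder_radial {g g' : ℝ → ℝ} (hg : ∀ s, 0 ≤ s → HasDerivAt g (g' s) s) {c : ℝ} (hc : 0 ≤ c)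
    (a : EuclideanSpace ℝ (Fin n)) (i : Fin n) :
    pder (fun y => g (c * ‖y - a‖ ^ 2)) i =
      fun x => g' (c * ‖x - a‖ ^ 2) * (2 * c * (x i - a i)) := by
  ext x
  have h := (hg (c * ‖x - a‖ ^ 2) (by positivity)).comp_hasFDerivAt x
    (hasFDerivAt_const_mul_norm_sub_sq c a x)
  have h' : fderiv ℝ (fun y => g (c * ‖y - a‖ ^ 2)) x = _ := h.fderiv
  rw [pder, h']
  simp [-mul_eq_mul_left_iff, EuclideanSpace.inner_single_right]
  ring

lemma lap_radial {g g' g'' : ℝ → ℝ} (hg : ∀ s, 0 ≤ s → HasDerivAt g (g' s) s)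
    (hg' : ∀ s, 0 ≤ s → HasDerivAt g' (g'' s) s) {c : ℝ} (hc : 0 ≤ c)
    (a x : EuclideanSpace ℝ (Fin n)) :
    lap (fun y => g (c * ‖y - a‖ ^ 2)) x =
      4 * c ^ 2 * ‖x - a‖ ^ 2 * g'' (c * ‖x - a‖ ^ 2) + 2 * n * c * g' (c * ‖x - a‖ ^ 2) := by
  have key : ∀ i : Fin n, pder (pder (fun y => g (c * ‖y - a‖ ^ 2)) i) i x =
      4 * c ^ 2 * (x i - a i) ^ 2 * g'' (c * ‖x - a‖ ^ 2) + 2 * c * g' (c * ‖x - a‖ ^ 2) := by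
    intro i
    rw [pder_radial hg hc, pder]
    have h1 := (hg' (c * ‖x - a‖ ^ 2) (by positivity)).comp_hasFDerivAt x
      (hasFDerivAt_const_mul_norm_sub_sq c a x)
    have h2 : HasFDerivAt (fun y : EuclideanSpace ℝ (Fin n) => 2 * c * (y i - a i))
        ((2 * c) • EuclideanSpace.proj i) x :=
      (((EuclideanSpace.proj (𝕜 := ℝ) i).hasFDerivAt (x := x)).sub_const (a i)).const_mul (2 * c)
    have h' : fderiv ℝ (fun y => g' (c * ‖y - a‖ ^ 2) * (2 * c * (y i - a i))) x = _ :=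
      (h1.mul h2).fderiv
    rw [h']
    simp [EuclideanSpace.inner_single_right]
    ring
  simp only [lap, key, Finset.sum_add_distrib, ← Finset.sum_mul, ← Finset.mul_sum]
  rw [EuclideanSpace.norm_sq_eq (x - a)]
  simp [-mul_eq_mul_left_iff, -mul_eq_mul_right_iff]
  ring

end Calculus

section MeanValue

variable {n : ℕ}

/-- The Laplacian of the rescaled profile `x ↦ prof (‖x‖² / t²)`. -/
def lapProf (t : ℝ) (x : EuclideanSpace ℝ (Fin n)) : ℝ :=
  4 * (t ^ 2)⁻¹ ^ 2 * ‖x‖ ^ 2 * prof'' ((t ^ 2)⁻¹ * ‖x‖ ^ 2) +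
    2 * n * (t ^ 2)⁻¹ * prof' ((t ^ 2)⁻¹ * ‖x‖ ^ 2)

lemma lap_prof (t : ℝ) (a x : EuclideanSpace ℝ (Fin n)) :
    lap (fun y => prof ((t ^ 2)⁻¹ * ‖y - a‖ ^ 2)) x = lapProf t (x - a) :=
  lap_radial (fun s _ => hasDerivAt_prof s) (fun s _ => hasDerivAt_prof' s) (by positivity) a x

lemma one_lt_inv_sq_mul_sq {t b s : ℝ} (ht : 0 < t) (htb : t ≤ b) (hs : b < s) :
    1 < (t ^ 2)⁻¹ * s ^ 2 := by
  rw [inv_mul_eq_div, one_lt_div (by positivity)]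
  nlinarith

lemma lapProf_eq_zero {t b : ℝ} (ht : 0 < t) (htb : t ≤ b) {x : EuclideanSpace ℝ (Fin n)}
    (hx : b < ‖x‖) : lapProf t x = 0 := by
  have := one_lt_inv_sq_mul_sq ht htb hx
  simp [lapProf, prof''_eq_zero this, prof'_eq_zero this.le]

lemma continuousOn_lapProf :
    ContinuousOn (fun z : ℝ × EuclideanSpace ℝ (Fin n) => lapProf z.1 z.2)
      (Set.Ioi 0 ×ˢ Set.univ) := by
  have h0 : ContinuousOn (fun z : ℝ × EuclideanSpace ℝ (Fin n) => (z.1 ^ 2)⁻¹)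
      (Set.Ioi 0 ×ˢ Set.univ) :=
    ContinuousOn.inv₀ (by fun_prop) (fun z hz => by have : 0 < z.1 := hz.1; positivity)
  have h1 : ContinuousOn (fun z : ℝ × EuclideanSpace ℝ (Fin n) => (z.1 ^ 2)⁻¹ * ‖z.2‖ ^ 2)
      (Set.Ioi 0 ×ˢ Set.univ) := h0.mul (by fun_prop)
  have h2 := continuous_prof'.comp_continuousOn h1
  have h3 := continuous_prof''.comp_continuousOn h1
  exact (((continuousOn_const.mul (h0.pow 2)).mul (by fun_prop)).mul h3).add
    ((continuousOn_const.mul h0).mul h2)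

lemma hasDerivAt_scaled_kernel {t : ℝ} (ht : 0 < t) (x : EuclideanSpace ℝ (Fin n)) :
    HasDerivAt (fun t : ℝ => (t ^ n)⁻¹ * (-2 * prof' ((t ^ 2)⁻¹ * ‖x‖ ^ 2)))
      (t * (t ^ n)⁻¹ * lapProf t x) t := by
  have h1 : HasDerivAt (fun t : ℝ => (t ^ n)⁻¹) (-(n * t ^ (n - 1)) / (t ^ n) ^ 2) t :=
    (hasDerivAt_pow n t).inv (by positivity)
  have h2 : HasDerivAt (fun t : ℝ => (t ^ 2)⁻¹) (-(2 * t) / (t ^ 2) ^ 2) t := by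
    refine ((hasDerivAt_pow 2 t).inv (by positivity)).congr_deriv ?_
    simp
  have h3 := ((hasDerivAt_prof' ((t ^ 2)⁻¹ * ‖x‖ ^ 2)).comp t (h2.mul_const (‖x‖ ^ 2))).const_mul
    (-2)
  refine (h1.mul h3).congr_deriv ?_
  have h4 : -(n * t ^ (n - 1)) / (t ^ n) ^ 2 = -n * t⁻¹ * (t ^ n)⁻¹ := by
    rcases n with _ | n
    · simp
    · simp only [Nat.add_sub_cancel]
      field_simp
      ring
  rw [h4]
  simp only [lapProf, Function.comp]
  field_simp
  ring

lemma integral_comp_mul_mollKer {v : EuclideanSpace ℝ (Fin n) → ℝ} {t : ℝ} (ht : 0 < t)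
    (a : EuclideanSpace ℝ (Fin n)) :
    ∫ y, v (a + t • y) * mollKer y =
      ∫ x, v (a + x) * ((t ^ n)⁻¹ * (-2 * prof' ((t ^ 2)⁻¹ * ‖x‖ ^ 2))) := by
  have h := Measure.integral_comp_smul (volume : Measure (EuclideanSpace ℝ (Fin n)))
    (fun x => v (a + x) * (-2 * prof' ((t ^ 2)⁻¹ * ‖x‖ ^ 2))) t
  have h1 : ∀ y : EuclideanSpace ℝ (Fin n), (t ^ 2)⁻¹ * ‖t • y‖ ^ 2 = ‖y‖ ^ 2 := by
    intro y
    rw [norm_smul, mul_pow, Real.norm_eq_abs, sq_abs]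
    field_simp
  simp only [h1] at h
  simp only [mollKer]
  rw [h, smul_eq_mul, ← integral_const_mul]
  congr 1; ext x
  rw [abs_of_pos (by positivity)]
  simp only [finrank_euclideanSpace, Fintype.card_fin]
  ring

lemma continuous_integral_comp_mul_mollKer {v : EuclideanSpace ℝ (Fin n) → ℝ} (hv : Continuous v)
    (a : EuclideanSpace ℝ (Fin n)) :
    Continuous fun t : ℝ => ∫ y, v (a + t • y) * mollKer y := by
  have h : ∀ t : ℝ, ∫ y, v (a + t • y) * mollKer y =
      ∫ y in closedBall 0 1, v (a + t • y) * mollKer y := by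
    intro t
    refine (setIntegral_eq_integral_of_forall_compl_eq_zero fun y hy => ?_).symm
    simp at hy
    rw [mollKer_eq_zero hy.le, mul_zero]
  simp only [h]
  refine continuous_parametric_integral_of_continuous ?_ (isCompact_closedBall 0 1)
  have := continuous_mollKer (n := n)
  simp only [Function.uncurry_def]
  fun_prop

lemma hasDerivAt_integral_comp_mul_mollKer {v : EuclideanSpace ℝ (Fin n) → ℝ} (hv : Continuous v)
    (a : EuclideanSpace ℝ (Fin n)) {t : ℝ} (ht : 0 < t) :
    HasDerivAt (fun t : ℝ => ∫ y, v (a + t • y) * mollKer y)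
      (t * (t ^ n)⁻¹ * ∫ x, v x * lapProf t (x - a)) t := by
  have hsub : Set.Icc (t / 2) (2 * t) ×ˢ closedBall (0 : EuclideanSpace ℝ (Fin n)) (2 * t) ⊆
      Set.Ioi (0 : ℝ) ×ˢ Set.univ := by
    rintro ⟨s, x⟩ ⟨hs, -⟩
    exact ⟨lt_of_lt_of_le (by positivity) hs.1, trivial⟩
  have hcont : ContinuousOn (fun z : ℝ × EuclideanSpace ℝ (Fin n) =>
      v (a + z.2) * (z.1 * (z.1 ^ n)⁻¹ * lapProf z.1 z.2)) (Set.Ioi 0 ×ˢ Set.univ) := by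
    refine ContinuousOn.mul (by fun_prop) (ContinuousOn.mul (continuousOn_fst.mul
      (ContinuousOn.inv₀ (by fun_prop) fun z hz => ?_)) continuousOn_lapProf)
    have : 0 < z.1 := hz.1
    positivity
  obtain ⟨C, hC⟩ := (isCompact_Icc.prod (isCompact_closedBall (0 : EuclideanSpace ℝ (Fin n))
    (2 * t))).exists_bound_of_continuousOn (hcont.mono hsub)
  have hnhds : Set.Icc (t / 2) (2 * t) ∈ nhds t := Icc_mem_nhds (by linarith) (by linarith)
  have hF : ∀ s : ℝ, Continuous fun x : EuclideanSpace ℝ (Fin n) =>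
      v (a + x) * ((s ^ n)⁻¹ * (-2 * prof' ((s ^ 2)⁻¹ * ‖x‖ ^ 2))) := by
    intro s
    have := continuous_prof'
    fun_prop
  have main := hasDerivAt_integral_of_dominated_loc_of_deriv_le
    (μ := (volume : Measure (EuclideanSpace ℝ (Fin n))))
    (F := fun s x => v (a + x) * ((s ^ n)⁻¹ * (-2 * prof' ((s ^ 2)⁻¹ * ‖x‖ ^ 2))))
    (F' := fun s x => v (a + x) * (s * (s ^ n)⁻¹ * lapProf s x))
    (bound := (closedBall (0 : EuclideanSpace ℝ (Fin n)) (2 * t)).indicator fun _ => C)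
    (x₀ := t) hnhds (Eventually.of_forall fun s => (hF s).aestronglyMeasurable) ?_ ?_ ?_ ?_ ?_
  · refine (main.2.congr_of_eventuallyEq ?_).congr_deriv ?_
    · filter_upwards [lt_mem_nhds ht] with s hs using integral_comp_mul_mollKer hs a
    · rw [← integral_add_left_eq_self (fun x => v x * lapProf t (x - a)) a, ← integral_const_mul]
      congr 1; ext x
      simp only [add_sub_cancel_left]
      ring
  · refine (hF t).integrable_of_hasCompactSupport
      (HasCompactSupport.intro (isCompact_closedBall 0 t) fun x hx => ?_)
    simp at hx
    simp [prof'_eq_zero (one_lt_inv_sq_mul_sq ht le_rfl hx).le]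
  · have : Continuous fun x : EuclideanSpace ℝ (Fin n) =>
        v (a + x) * (t * (t ^ n)⁻¹ * lapProf t x) :=
      (hcont.comp_continuous (f := fun x => (t, x)) (by fun_prop) fun x => ⟨ht, trivial⟩ :)
    exact this.aestronglyMeasurable
  · refine Eventually.of_forall fun x s hs => ?_
    by_cases hx : x ∈ closedBall (0 : EuclideanSpace ℝ (Fin n)) (2 * t)
    · rw [Set.indicator_of_mem hx]
      exact hC (s, x) ⟨hs, hx⟩
    · rw [Set.indicator_of_notMem hx]
      simp at hx
      have hs0 : 0 < s := lt_of_lt_of_le (by positivity) hs.1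
      simp [lapProf_eq_zero hs0 hs.2 hx]
  · exact (integrable_indicator_iff measurableSet_closedBall).2
      (integrableOn_const (isCompact_closedBall _ _).measure_lt_top.ne)
  · refine Eventually.of_forall fun x s hs => ?_
    have hs0 : 0 < s := lt_of_lt_of_le (by positivity) hs.1
    exact (hasDerivAt_scaled_kernel hs0 x).const_mul _

/-- Mean value inequality for a continuous function whose distributional Laplacian is nonnegative
on the radial test functions centred at `a`. -/
lemma mean_value_inequality {v : EuclideanSpace ℝ (Fin n) → ℝ} (hv : Continuous v)
    {a : EuclideanSpace ℝ (Fin n)} {S : ℝ} (hS : 0 < S)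
    (h : ∀ t ∈ Set.Ioo 0 S, 0 ≤ ∫ x, v x * lap (fun y => prof ((t ^ 2)⁻¹ * ‖y - a‖ ^ 2)) x) :
    (∫ y : EuclideanSpace ℝ (Fin n), mollKer y) * v a ≤ ∫ y, v (a + S • y) * mollKer y := by
  have hmono : MonotoneOn (fun t : ℝ => ∫ y, v (a + t • y) * mollKer y) (Set.Icc 0 S) := by
    refine monotoneOn_of_deriv_nonneg (convex_Icc 0 S)
      (continuous_integral_comp_mul_mollKer hv a).continuousOn ?_ ?_
    · rw [interior_Icc]
      exact fun t ht => (hasDerivAt_integral_comp_mul_mollKer hv a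
        ht.1).differentiableAt.differentiableWithinAt
    · rw [interior_Icc]
      intro t ht
      rw [(hasDerivAt_integral_comp_mul_mollKer hv a ht.1).deriv]
      have := h t ht
      simp only [lap_prof] at this
      have := ht.1
      positivity
  have := hmono (Set.left_mem_Icc.2 hS.le) (Set.right_mem_Icc.2 hS.le) hS.le
  simp only [zero_smul, add_zero] at this
  rw [integral_const_mul] at this
  linarith

end MeanValue

section IntegrationByParts

variable {n : ℕ}

lemma inner_gradient_eq_sum (u φ : EuclideanSpace ℝ (Fin n) → ℝ) (x : EuclideanSpace ℝ (Fin n)) :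
    ⟪gradient u x, gradient φ x⟫ = ∑ i, pder u i x * pder φ i x := by
  have h : ∀ (f : EuclideanSpace ℝ (Fin n) → ℝ) (i : Fin n), gradient f x i = pder f i x := by
    intro f i
    have := inner_gradient_left (𝕜 := ℝ) (f := f) (x := x) (y := EuclideanSpace.single i (1 : ℝ))
    rw [pder, ← this, EuclideanSpace.inner_single_right]
    simp
  rw [PiLp.inner_apply]
  refine Finset.sum_congr rfl fun i _ => ?_
  rw [h, h]
  simp [mul_comm]

lemma contDiff_pder {k : ℕ} {f : EuclideanSpace ℝ (Fin n) → ℝ}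
    (hf : ContDiff ℝ ((k + 1 : ℕ) : WithTop ℕ∞) f) (i : Fin n) :
    ContDiff ℝ (k : WithTop ℕ∞) (pder f i) :=
  (hf.fderiv_right (by norm_cast)).clm_apply contDiff_const

lemma hasCompactSupport_pder {f : EuclideanSpace ℝ (Fin n) → ℝ} (hf : HasCompactSupport f)
    (i : Fin n) : HasCompactSupport (pder f i) :=
  hf.fderiv_apply (𝕜 := ℝ) _

lemma continuous_lap {f : EuclideanSpace ℝ (Fin n) → ℝ} (hf : ContDiff ℝ 2 f) :
    Continuous (lap f) :=
  continuous_finsetSum _ fun i _ =>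
    (contDiff_pder (k := 0) (contDiff_pder (k := 1) hf i) i).continuous

lemma hasCompactSupport_lap {f : EuclideanSpace ℝ (Fin n) → ℝ} (hf : HasCompactSupport f) :
    HasCompactSupport (lap f) := by
  refine HasCompactSupport.intro hf fun x hx => Finset.sum_eq_zero fun i _ => ?_
  refine image_eq_zero_of_notMem_tsupport fun h => hx ?_
  have h1 : tsupport (pder f i) ⊆ tsupport f := tsupport_fderiv_apply_subset ℝ _
  have h2 : tsupport (pder (pder f i) i) ⊆ tsupport (pder f i) := tsupport_fderiv_apply_subset ℝ _
  exact h1 (h2 h)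

lemma integral_mul_lap {w φ : EuclideanSpace ℝ (Fin n) → ℝ} (hw : ContDiff ℝ 2 w)
    (hφ : ContDiff ℝ 2 φ) (hc : HasCompactSupport φ) :
    ∫ x, w x * lap φ x = ∫ x, lap w x * φ x := by
  have hw1 := fun i => contDiff_pder (k := 1) hw i
  have hφ1 := fun i => contDiff_pder (k := 1) hφ i
  have hw2 := fun i => (contDiff_pder (k := 0) (hw1 i) i).continuous
  have hφ2 := fun i => (contDiff_pder (k := 0) (hφ1 i) i).continuous
  have hc1 := fun i => hasCompactSupport_pder hc i
  have hc2 := fun i => hasCompactSupport_pder (hc1 i) i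
  have i0 : ∀ i, Integrable fun x => w x * pder (pder φ i) i x := fun i =>
    (hw.continuous.mul (hφ2 i)).integrable_of_hasCompactSupport (hc2 i).mul_left
  have i1 : ∀ i, Integrable fun x => pder w i x * pder φ i x := fun i =>
    ((hw1 i).continuous.mul (hφ1 i).continuous).integrable_of_hasCompactSupport (hc1 i).mul_left
  have i2 : ∀ i, Integrable fun x => pder (pder w i) i x * φ x := fun i =>
    ((hw2 i).mul hφ.continuous).integrable_of_hasCompactSupport hc.mul_left
  have i3 : ∀ i, Integrable fun x => w x * pder φ i x := fun i =>
    (hw.continuous.mul (hφ1 i).continuous).integrable_of_hasCompactSupport (hc1 i).mul_left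
  have i4 : ∀ i, Integrable fun x => pder w i x * φ x := fun i =>
    ((hw1 i).continuous.mul hφ.continuous).integrable_of_hasCompactSupport hc.mul_left
  simp only [lap, Finset.mul_sum, Finset.sum_mul]
  rw [integral_finsetSum _ fun i _ => i0 i, integral_finsetSum _ fun i _ => i2 i]
  refine Finset.sum_congr rfl fun i _ => ?_
  have e1 : ∫ x, w x * pder (pder φ i) i x = -∫ x, pder w i x * pder φ i x :=
    integral_mul_fderiv_eq_neg_fderiv_mul_of_integrable (i1 i) (i0 i) (i3 i)
      (fun x _ => hw.differentiable (by norm_num) x)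
      (fun x _ => (hφ1 i).differentiable (by norm_num) x)
  have e2 : ∫ x, pder w i x * pder φ i x = -∫ x, pder (pder w i) i x * φ x :=
    integral_mul_fderiv_eq_neg_fderiv_mul_of_integrable (i2 i) (i1 i) (i4 i)
      (fun x _ => (hw1 i).differentiable (by norm_num) x)
      (fun x _ => hφ.differentiable (by norm_num) x)
  rw [e1, e2, neg_neg]

lemma integrable_inner_gradient_and_integral_eq {K : NNReal} {u φ : EuclideanSpace ℝ (Fin n) → ℝ}
    (hu : LipschitzWith K u) (hφ : ContDiff ℝ 2 φ) (hc : HasCompactSupport φ) :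
    Integrable (fun x => ⟪gradient u x, gradient φ x⟫) ∧
      ∫ x, ⟪gradient u x, gradient φ x⟫ = -∫ x, u x * lap φ x := by
  have hφ1 := fun i => contDiff_pder (k := 1) hφ i
  have hφ2 := fun i => (contDiff_pder (k := 0) (hφ1 i) i).continuous
  have hc1 := fun i => hasCompactSupport_pder hc i
  have hc2 := fun i => hasCompactSupport_pder (hc1 i) i
  have hae : (fun x => ⟪gradient u x, gradient φ x⟫) =ᵐ[volume]
      fun x => ∑ i, lineDeriv ℝ u x (EuclideanSpace.single i 1) * pder φ i x := by
    filter_upwards [hu.ae_differentiableAt (μ := volume)] with x hx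
    rw [inner_gradient_eq_sum]
    refine Finset.sum_congr rfl fun i _ => ?_
    rw [hx.lineDeriv_eq_fderiv, pder]
  have i0 : ∀ i : Fin n, Integrable fun x =>
      lineDeriv ℝ u x (EuclideanSpace.single i 1) * pder φ i x := fun i =>
    (hu.locallyIntegrable_lineDeriv _).integrable_smul_right_of_hasCompactSupport
      (hφ1 i).continuous (hc1 i)
  have i1 : ∀ i : Fin n, Integrable fun x => u x * pder (pder φ i) i x := fun i =>
    (hu.continuous.mul (hφ2 i)).integrable_of_hasCompactSupport (hc2 i).mul_left
  refine ⟨(integrable_congr hae).2 (integrable_finsetSum _ fun i _ => i0 i), ?_⟩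
  rw [integral_congr_ae hae, integral_finsetSum _ fun i _ => i0 i]
  simp only [lap, Finset.mul_sum]
  rw [integral_finsetSum _ fun i _ => i1 i, ← Finset.sum_neg_distrib]
  refine Finset.sum_congr rfl fun i _ => ?_
  obtain ⟨D, hD⟩ := ContDiff.lipschitzWith_of_hasCompactSupport (hc1 i) (hφ1 i) (by norm_num)
  rw [hu.integral_lineDeriv_mul_eq hD (hc1 i), ← integral_neg]
  congr 1; ext x
  rw [((hφ1 i).differentiable (by norm_num) x).lineDeriv_eq_fderiv, map_neg]
  simp only [pder]
  ring

end IntegrationByParts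

section Exterior

variable {n : ℕ}

lemma contDiff_prof_norm_sub_sq {k : ℕ∞} (c : ℝ) (a : EuclideanSpace ℝ (Fin n)) :
    ContDiff ℝ k fun y => prof (c * ‖y - a‖ ^ 2) :=
  contDiff_prof.comp (contDiff_const.mul ((contDiff_id.sub contDiff_const).norm_sq ℝ))

lemma tsupport_prof_subset {t : ℝ} (ht : 0 < t) (a : EuclideanSpace ℝ (Fin n)) :
    tsupport (fun y => prof ((t ^ 2)⁻¹ * ‖y - a‖ ^ 2)) ⊆ closedBall a t := by
  refine closure_minimal (fun y hy => ?_) isClosed_closedBall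
  by_contra h
  simp only [mem_closedBall, dist_eq_norm, not_le] at h
  exact hy (prof_eq_zero (one_lt_inv_sq_mul_sq ht le_rfl h).le)

lemma integral_sub_mul_lap_nonneg {Ω : Set (EuclideanSpace ℝ (Fin n))}
    {u F : EuclideanSpace ℝ (Fin n) → ℝ}
    (hweak : IsWeakSupersol Ω u F) {a : EuclideanSpace ℝ (Fin n)} {S : ℝ}
    (hS : closedBall a S ⊆ interior Ω) (hF : ContinuousOn F (closedBall a S))
    {v : EuclideanSpace ℝ (Fin n) → ℝ} {K : NNReal} (hv : LipschitzWith K v)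
    (huv : Set.EqOn u v (closedBall a S)) {w : EuclideanSpace ℝ (Fin n) → ℝ}
    (hw : ContDiff ℝ 2 w) (hle : ∀ x ∈ closedBall a S, F x + lap w x ≤ 0)
    {φ : EuclideanSpace ℝ (Fin n) → ℝ} (hφ : ContDiff ℝ (⊤ : ℕ∞) φ) (hφ0 : ∀ x, 0 ≤ φ x)
    (hsupp : tsupport φ ⊆ ball a S) :
    0 ≤ ∫ x, (v x - w x) * lap φ x := by
  have hc : HasCompactSupport φ :=
    (isCompact_closedBall a S).of_isClosed_subset (isClosed_tsupport φ)
      (hsupp.trans ball_subset_closedBall)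
  have hφ2 : ContDiff ℝ 2 φ := contDiff_infty.1 hφ 2
  have h0 := hweak φ hφ hc (hsupp.trans (ball_subset_closedBall.trans hS)) hφ0
  obtain ⟨j1, e1⟩ := integrable_inner_gradient_and_integral_eq hv hφ2 hc
  have hzero : ∀ x, x ∉ tsupport φ → gradient φ x = 0 ∧ φ x = 0 := by
    intro x hx
    refine ⟨?_, image_eq_zero_of_notMem_tsupport hx⟩
    have : fderiv ℝ φ x = 0 := image_eq_zero_of_notMem_tsupport
      fun h => hx (tsupport_fderiv_subset ℝ h)
    simp [gradient, this]
  have hgrad : ∀ x, ⟪gradient u x, gradient φ x⟫ = ⟪gradient v x, gradient φ x⟫ := by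
    intro x
    by_cases hx : x ∈ tsupport φ
    · have : u =ᶠ[nhds x] v := by
        filter_upwards [isOpen_ball.mem_nhds (hsupp hx)] with y hy
          using huv (ball_subset_closedBall hy)
      rw [this.gradient.eq_of_nhds]
    · simp [(hzero x hx).1]
  have j2 : Integrable fun x => F x * φ x := by
    have : IntegrableOn (fun x => F x * φ x) (closedBall a S) :=
      (hF.mul hφ.continuous.continuousOn).integrableOn_compact (isCompact_closedBall a S)
    refine (integrableOn_iff_integrable_of_support_subset fun x hx => ?_).1 this
    by_contra h
    exact hx (by simp [(hzero x fun h' => h (ball_subset_closedBall (hsupp h'))).2])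
  have j3 : Integrable fun x => lap w x * φ x :=
    ((continuous_lap hw).mul hφ.continuous).integrable_of_hasCompactSupport hc.mul_left
  have hset : ∫ x in Ω, (-⟪gradient u x, gradient φ x⟫ + F x * φ x) =
      ∫ x, (-⟪gradient v x, gradient φ x⟫ + F x * φ x) := by
    simp only [hgrad]
    refine setIntegral_eq_integral_of_forall_compl_eq_zero fun x hx => ?_
    have := hzero x fun h => hx (interior_subset (hS (ball_subset_closedBall (hsupp h))))
    simp [this.1, this.2]
  rw [hset] at h0
  have hmono : ∫ x, (-⟪gradient v x, gradient φ x⟫ + F x * φ x) ≤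
      ∫ x, (-⟪gradient v x, gradient φ x⟫ - lap w x * φ x) := by
    refine integral_mono (j1.neg.add j2) (j1.neg.sub j3) fun x => ?_
    by_cases hx : x ∈ tsupport φ
    · have := hle x (ball_subset_closedBall (hsupp hx))
      have := mul_nonneg (neg_nonneg.2 this) (hφ0 x)
      simp only
      linarith
    · simp [(hzero x hx).2]
  rw [integral_sub (f := fun x => -⟪gradient v x, gradient φ x⟫) j1.neg j3, integral_neg, e1,
    ← integral_mul_lap hw hφ2 hc] at hmono
  simp only [sub_mul]
  have hlc := continuous_lap hφ2
  have hls := hasCompactSupport_lap hc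
  rw [integral_sub (f := fun x => v x * lap φ x) (g := fun x => w x * lap φ x)
    ((hv.continuous.mul hlc).integrable_of_hasCompactSupport hls.mul_left)
    ((hw.continuous.mul hlc).integrable_of_hasCompactSupport hls.mul_left)]
  linarith

/-- Mean value inequality for `u - w`, where `u` is a weak subsolution of `Δu + F = 0` and `w` is
a strong supersolution. -/
lemma mean_value_inequality_sub {Ω : Set (EuclideanSpace ℝ (Fin n))}
    {u F : EuclideanSpace ℝ (Fin n) → ℝ} (hu : LocallyLipschitzOn Ω u)
    (hweak : IsWeakSupersol Ω u F) {a : EuclideanSpace ℝ (Fin n)} {S : ℝ} (hS0 : 0 < S)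
    (hS : closedBall a S ⊆ interior Ω) (hF : ContinuousOn F (closedBall a S))
    {w : EuclideanSpace ℝ (Fin n) → ℝ}
    (hw : ContDiff ℝ 2 w) (hle : ∀ x ∈ closedBall a S, F x + lap w x ≤ 0) :
    (∫ y : EuclideanSpace ℝ (Fin n), mollKer y) * (u a - w a) ≤
      ∫ y, (u (a + S • y) - w (a + S • y)) * mollKer y := by
  obtain ⟨K, hK⟩ := (hu.mono (hS.trans interior_subset)).exists_lipschitzOnWith_of_compact
    (isCompact_closedBall a S)
  obtain ⟨v, hv, huv⟩ := hK.extend_real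
  have h := mean_value_inequality (v := fun x => v x - w x) (hv.continuous.sub hw.continuous)
    (a := a) hS0 fun t ht => integral_sub_mul_lap_nonneg hweak hS hF hv huv hw hle
      (contDiff_prof_norm_sub_sq _ a) (fun x => prof_nonneg _)
      ((tsupport_prof_subset ht.1 a).trans (closedBall_subset_ball ht.2))
  rw [huv (mem_closedBall_self hS0.le)]
  convert h using 1
  refine integral_congr_ae (Eventually.of_forall fun y => ?_)
  simp only
  rcases le_or_gt 1 ‖y‖ with hy | hy
  · simp [mollKer_eq_zero hy]
  · rw [huv]
    simp only [mem_closedBall, dist_eq_norm, add_sub_cancel_left, norm_smul, Real.norm_eq_abs,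
      abs_of_pos hS0]
    nlinarith

end Exterior

section Touching

variable {n : ℕ}

lemma lap_add {f g : EuclideanSpace ℝ (Fin n) → ℝ} (hf : ContDiff ℝ 2 f) (hg : ContDiff ℝ 2 g)
    (x : EuclideanSpace ℝ (Fin n)) : lap (fun y => f y + g y) x = lap f x + lap g x := by
  simp only [lap, ← Finset.sum_add_distrib]
  refine Finset.sum_congr rfl fun i _ => ?_
  have h1 : pder (fun y => f y + g y) i = fun y => pder f i y + pder g i y := by
    ext y
    simp only [pder]
    rw [fderiv_fun_add (hf.differentiable (by norm_num) y) (hg.differentiable (by norm_num) y)]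
    rfl
  rw [h1, pder, fderiv_fun_add ((contDiff_pder (k := 1) hf i).differentiable (by norm_num) x)
    ((contDiff_pder (k := 1) hg i).differentiable (by norm_num) x)]
  rfl

lemma lap_const_mul {f : EuclideanSpace ℝ (Fin n) → ℝ} (hf : ContDiff ℝ 2 f) (c : ℝ)
    (x : EuclideanSpace ℝ (Fin n)) : lap (fun y => c * f y) x = c * lap f x := by
  simp only [lap, Finset.mul_sum]
  refine Finset.sum_congr rfl fun i _ => ?_
  have h1 : pder (fun y => c * f y) i = fun y => c * pder f i y := by
    ext y
    simp only [pder]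
    rw [fderiv_const_mul (hf.differentiable (by norm_num) y)]
    rfl
  rw [h1, pder, fderiv_const_mul ((contDiff_pder (k := 1) hf i).differentiable (by norm_num) x)]
  rfl

lemma contDiff_const_mul_norm_sub_sq {k : WithTop ℕ∞} (c : ℝ) (a : EuclideanSpace ℝ (Fin n)) :
    ContDiff ℝ k fun y => c * ‖y - a‖ ^ 2 :=
  contDiff_const.mul ((contDiff_id.sub contDiff_const).norm_sq ℝ)

lemma lap_const_mul_norm_sub_sq (c : ℝ) (a x : EuclideanSpace ℝ (Fin n)) :
    lap (fun y => c * ‖y - a‖ ^ 2) x = 2 * n * c := by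
  have h := lap_radial (g := fun s => c * s) (g' := fun _ => c) (g'' := fun _ => 0)
    (fun s _ => by simpa using (hasDerivAt_id s).const_mul c)
    (fun s _ => hasDerivAt_const s c) zero_le_one a x
  simpa using h

lemma integrable_comp_mul_mollKer {f : EuclideanSpace ℝ (Fin n) → ℝ}
    {a : EuclideanSpace ℝ (Fin n)} {S : ℝ} (hS : 0 < S) (hf : ContinuousOn f (closedBall a S)) :
    Integrable fun y => f (a + S • y) * mollKer y := by
  have hmaps : Set.MapsTo (fun y : EuclideanSpace ℝ (Fin n) => a + S • y) (closedBall 0 1)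
      (closedBall a S) := by
    intro y hy
    simp only [mem_closedBall, dist_eq_norm, sub_zero, add_sub_cancel_left, norm_smul,
      Real.norm_eq_abs, abs_of_pos hS] at hy ⊢
    nlinarith
  have h : IntegrableOn (fun y => f (a + S • y) * mollKer y) (closedBall 0 1) :=
    ((hf.comp (f := fun y => a + S • y) (by fun_prop) hmaps).mul
      continuous_mollKer.continuousOn).integrableOn_compact (isCompact_closedBall 0 1)
  refine (integrableOn_iff_integrable_of_support_subset fun y hy => ?_).1 h
  by_contra hy'
  simp only [mem_closedBall, dist_eq_norm, sub_zero, not_le] at hy'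
  exact hy (by simp [mollKer_eq_zero hy'.le])

/-- A weak subsolution of `Δu + F = 0` is a viscosity subsolution. -/
lemma nonneg_of_touching (hn : 0 < n) {Ω : Set (EuclideanSpace ℝ (Fin n))}
    {u F W : EuclideanSpace ℝ (Fin n) → ℝ} (hu : LocallyLipschitzOn Ω u)
    (hF : ContinuousOn F Ω) (hweak : IsWeakSupersol Ω u F) (hW : ContDiff ℝ 2 W)
    {a : EuclideanSpace ℝ (Fin n)} (ha : a ∈ interior Ω) (hle : ∀ᶠ x in nhds a, u x ≤ W x)
    (heq : u a = W a) : 0 ≤ F a + lap W a := by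
  by_contra! hneg
  have hn' : (0 : ℝ) < n := by exact_mod_cast hn
  set c : ℝ := -(F a + lap W a) / (4 * n) with hc
  have hc0 : 0 < c := div_pos (by linarith) (by positivity)
  have hcn : F a + lap W a = -(4 * n * c) := by rw [hc]; field_simp
  have hGc : ContinuousAt (fun x => F x + lap W x) a :=
    (hF.continuousAt (mem_interior_iff_mem_nhds.1 ha)).add (continuous_lap hW).continuousAt
  have hG : ∀ᶠ x in nhds a, F x + lap W x < -(2 * n * c) :=
    hGc.eventually (gt_mem_nhds (by
      show F a + lap W a < _
      rw [hcn]; nlinarith [mul_pos hn' hc0]))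
  obtain ⟨S, hS0, hS⟩ := nhds_basis_closedBall.eventually_iff.1
    (hG.and (hle.and (isOpen_interior.mem_nhds ha)))
  have hsub : closedBall a S ⊆ interior Ω := fun x hx => (hS hx).2.2
  have hq := contDiff_const_mul_norm_sub_sq (k := 2) c a
  have h := mean_value_inequality_sub hu hweak hS0 hsub
    (hF.mono (hsub.trans interior_subset)) (w := fun x => W x + c * ‖x - a‖ ^ 2) (hW.add hq)
    fun x hx => by
      rw [lap_add hW hq, lap_const_mul_norm_sub_sq]
      have := (hS hx).1
      linarith
  have hint := integral_norm_sq_mul_mollKer_pos hn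
  have hbound : ∫ y, (u (a + S • y) - (W (a + S • y) + c * ‖a + S • y - a‖ ^ 2)) * mollKer y ≤
      ∫ y : EuclideanSpace ℝ (Fin n), -(c * S ^ 2) * (‖y‖ ^ 2 * mollKer y) := by
    refine integral_mono (integrable_comp_mul_mollKer
      (f := fun x => u x - (W x + c * ‖x - a‖ ^ 2)) hS0 ?_) ?_ fun y => ?_
    · exact (hu.continuousOn.mono (hsub.trans interior_subset)).sub
        (hW.continuous.add hq.continuous).continuousOn
    · exact (((continuous_norm.pow 2).mul continuous_mollKer).integrable_of_hasCompactSupport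
        hasCompactSupport_mollKer.mul_left).const_mul _
    · simp only
      rcases le_or_gt 1 ‖y‖ with hy | hy
      · simp [mollKer_eq_zero hy]
      · have hmem : a + S • y ∈ closedBall a S := by
          simp only [mem_closedBall, dist_eq_norm, add_sub_cancel_left, norm_smul,
            Real.norm_eq_abs, abs_of_pos hS0]
          nlinarith
        have h1 := (hS hmem).2.1
        have h2 := mollKer_nonneg y
        rw [add_sub_cancel_left, norm_smul, Real.norm_eq_abs, mul_pow, sq_abs]
        nlinarith [mul_nonneg (sub_nonneg.2 h1) h2]
  rw [integral_const_mul] at hbound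
  have h0 : u a - (W a + c * ‖a - a‖ ^ 2) = 0 := by simp [heq]
  have h1 := h.trans hbound
  rw [h0, mul_zero] at h1
  have : 0 < c * S ^ 2 * ∫ y : EuclideanSpace ℝ (Fin n), ‖y‖ ^ 2 * mollKer y := by positivity
  linarith

end Touching

section LocalBound

variable {n : ℕ}

lemma le_add_rpow_mul_rpow {p θ x : ℝ} (hp : 1 < p) (hθ : 0 < θ) (hx : 0 ≤ x) :
    x ≤ θ + θ ^ (1 - p) * x ^ p := by
  rcases le_or_gt x θ with h | h
  · have : 0 ≤ θ ^ (1 - p) * x ^ p := by positivity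
    linarith
  · have hx0 : 0 < x := hθ.trans h
    have h1 : x ^ (1 - p) ≤ θ ^ (1 - p) :=
      Real.rpow_le_rpow_of_nonpos hθ h.le (by linarith)
    have h2 : x = x ^ (1 - p) * x ^ p := by
      rw [← Real.rpow_add hx0]; simp
    have h3 := mul_le_mul_of_nonneg_right h1 (Real.rpow_nonneg hx p)
    linarith

lemma integral_indicator_comp {f : EuclideanSpace ℝ (Fin n) → ℝ} {a : EuclideanSpace ℝ (Fin n)}
    {S : ℝ} (hS : 0 < S) :
    ∫ y, (closedBall a S).indicator f (a + S • y) = (S ^ n)⁻¹ * ∫ x in closedBall a S, f x := by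
  have h := Measure.integral_comp_smul (volume : Measure (EuclideanSpace ℝ (Fin n)))
    (fun x => (closedBall a S).indicator f (a + x)) S
  rw [h, integral_add_left_eq_self (fun x => (closedBall a S).indicator f x) a,
    integral_indicator measurableSet_closedBall, abs_of_pos (by positivity)]
  simp

lemma exists_rpow_mul_le_integral (n : ℕ) (hn : 0 < n) {p : ℝ} (hp : 1 < p) :
    ∃ K : ℝ, 0 < K ∧ ∀ (Ω : Set (EuclideanSpace ℝ (Fin n)))
      (u F : EuclideanSpace ℝ (Fin n) → ℝ), (∀ x ∈ Ω, 0 ≤ u x) → LocallyLipschitzOn Ω u →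
      ContinuousOn F Ω → IsWeakSupersol Ω u F → ∀ (a : EuclideanSpace ℝ (Fin n)) (S A : ℝ),
      0 < S → closedBall a S ⊆ interior Ω → (∀ x ∈ closedBall a S, F x ≤ A) → 0 ≤ A →
      0 < u a → A * S ^ 2 ≤ u a / 2 →
      u a ^ p * S ^ n ≤ K * ∫ x in closedBall a S, u x ^ p := by
  obtain ⟨B, hB0, hB⟩ := exists_mollKer_le (n := n)
  have hm := integral_mollKer_pos (n := n)
  set m := ∫ y : EuclideanSpace ℝ (Fin n), mollKer y with hm_def
  refine ⟨4 ^ p * B / (2 * m), by positivity, ?_⟩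
  intro Ω u F hu0 hu hF hweak a S A hS0 hsub hFA hA0 hM hAS
  set M := u a with hM_def
  have hn' : (1 : ℝ) ≤ n := by exact_mod_cast hn
  have hsubΩ := hsub.trans interior_subset
  have hq := contDiff_const_mul_norm_sub_sq (k := 2) (-(A / (2 * n))) a
  have hMV := mean_value_inequality_sub hu hweak hS0 hsub (hF.mono hsubΩ) hq fun x hx => by
    rw [lap_const_mul_norm_sub_sq]
    have h1 := hFA x hx
    have h2 : 2 * n * -(A / (2 * n)) = -A := by field_simp
    linarith
  set f : EuclideanSpace ℝ (Fin n) → ℝ := fun x => u x ^ p with hf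
  have hfc : ContinuousOn f (closedBall a S) :=
    (hu.continuousOn.mono hsubΩ).rpow_const fun x hx => Or.inr (by linarith)
  have hind : Integrable fun y => (closedBall a S).indicator f (a + S • y) := by
    have h1 : Integrable ((closedBall a S).indicator f) :=
      (integrable_indicator_iff measurableSet_closedBall).2
        (hfc.integrableOn_compact (isCompact_closedBall a S))
    exact (h1.comp_add_left a).comp_smul hS0.ne'
  have hkint : Integrable (mollKer (n := n)) :=
    continuous_mollKer.integrable_of_hasCompactSupport hasCompactSupport_mollKer
  have hbound : ∫ y, (u (a + S • y) - -(A / (2 * n)) * ‖a + S • y - a‖ ^ 2) * mollKer y ≤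
      ∫ y, (M / 2 * mollKer y +
        (M / 4) ^ (1 - p) * B * (closedBall a S).indicator f (a + S • y)) := by
    refine integral_mono (integrable_comp_mul_mollKer
      (f := fun x => u x - -(A / (2 * n)) * ‖x - a‖ ^ 2) hS0
      ((hu.continuousOn.mono hsubΩ).sub hq.continuous.continuousOn))
      ((hkint.const_mul _).add (hind.const_mul _)) fun y => ?_
    simp only
    rcases le_or_gt 1 ‖y‖ with hy | hy
    · rw [mollKer_eq_zero hy, mul_zero, mul_zero, zero_add]
      refine mul_nonneg (by positivity) (Set.indicator_nonneg (fun x hx => ?_) _)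
      exact Real.rpow_nonneg (hu0 x (hsubΩ hx)) p
    · have hmem : a + S • y ∈ closedBall a S := by
        simp only [mem_closedBall, dist_eq_norm, add_sub_cancel_left, norm_smul,
          Real.norm_eq_abs, abs_of_pos hS0]
        nlinarith
      rw [Set.indicator_of_mem hmem, add_sub_cancel_left, norm_smul, Real.norm_eq_abs, mul_pow,
        sq_abs]
      have hux := hu0 _ (hsubΩ hmem)
      have h1 := le_add_rpow_mul_rpow hp (by positivity : 0 < M / 4) hux
      have h2 : A / (2 * n) * (S ^ 2 * ‖y‖ ^ 2) ≤ M / 4 := by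
        have e1 : A / (2 * n) ≤ A / 2 := by gcongr; linarith
        have e2 : S ^ 2 * ‖y‖ ^ 2 ≤ S ^ 2 := by
          have : ‖y‖ ^ 2 ≤ 1 := pow_le_one₀ (norm_nonneg y) hy.le
          nlinarith [sq_nonneg S]
        calc A / (2 * n) * (S ^ 2 * ‖y‖ ^ 2) ≤ A / 2 * S ^ 2 := by gcongr
          _ ≤ M / 4 := by linarith
      have h3 := mollKer_nonneg y
      have h4 := hB y
      have h5 : 0 ≤ (M / 4) ^ (1 - p) * f (a + S • y) :=
        mul_nonneg (by positivity) (Real.rpow_nonneg hux p)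
      calc (u (a + S • y) - -(A / (2 * n)) * (S ^ 2 * ‖y‖ ^ 2)) * mollKer y
          ≤ (M / 2 + (M / 4) ^ (1 - p) * f (a + S • y)) * mollKer y := by
            refine mul_le_mul_of_nonneg_right ?_ h3
            simp only [hf]
            linarith
        _ ≤ M / 2 * mollKer y + (M / 4) ^ (1 - p) * B * f (a + S • y) := by
            nlinarith [mul_le_mul_of_nonneg_left h4 h5]
  rw [integral_add (hkint.const_mul _) (hind.const_mul _), integral_const_mul, integral_const_mul,
    integral_indicator_comp hS0] at hbound
  rw [sub_self, norm_zero] at hMV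
  norm_num at hMV
  norm_num at hbound
  set I := ∫ x in closedBall a S, f x
  have h6 : 2 * m * (M / 4) ≤ (M / 4) ^ (1 - p) * B * ((S ^ n)⁻¹ * I) := by
    have := hMV.trans hbound
    rw [← hm_def] at this
    linarith
  have h7 : (M / 4) ^ (p - 1) * (M / 4) ^ (1 - p) = 1 := by
    rw [← Real.rpow_add (by positivity)]; simp
  have h8 : (M / 4) ^ (p - 1) * (M / 4) = M ^ p / 4 ^ p := by
    rw [← Real.div_rpow hM.le (by norm_num), ← Real.rpow_add_one (by positivity)]; simp
  have h9 := mul_le_mul_of_nonneg_left h6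
    (Real.rpow_nonneg (by positivity : 0 ≤ M / 4) (p - 1))
  have h10 : 2 * m * (M ^ p / 4 ^ p) ≤ B * ((S ^ n)⁻¹ * I) := by
    calc 2 * m * (M ^ p / 4 ^ p) = (M / 4) ^ (p - 1) * (2 * m * (M / 4)) := by rw [← h8]; ring
      _ ≤ _ := h9
      _ = ((M / 4) ^ (p - 1) * (M / 4) ^ (1 - p)) * (B * ((S ^ n)⁻¹ * I)) := by ring
      _ = _ := by rw [h7, one_mul]
  have h11 := mul_le_mul_of_nonneg_left h10
    (by positivity : (0 : ℝ) ≤ S ^ n * 4 ^ p / (2 * m))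
  calc M ^ p * S ^ n = S ^ n * 4 ^ p / (2 * m) * (2 * m * (M ^ p / 4 ^ p)) := by
        field_simp
    _ ≤ _ := h11
    _ = _ := by field_simp

end LocalBound

section EpsRegularity

variable {n : ℕ}

/-- Point picking: the integral controls the value at the center once it is small. -/
lemma exists_pow_mul_rpow_le_integral (n : ℕ) (hn : 0 < n) {p q C0 : ℝ} (hp : 1 < p)
    (hq : q = (2 * p + n) / n) (hC0 : 0 < C0) :
    ∃ K e : ℝ, 0 < K ∧ 0 < e ∧ ∀ (Ω : Set (EuclideanSpace ℝ (Fin n)))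
      (u : EuclideanSpace ℝ (Fin n) → ℝ), (∀ x ∈ Ω, 0 ≤ u x) → LocallyLipschitzOn Ω u →
      IsWeakSupersol Ω u (fun x => C0 * u x ^ q) → ∀ (x₀ : EuclideanSpace ℝ (Fin n)) (ρ : ℝ),
      0 < ρ → closedBall x₀ ρ ⊆ interior Ω → ∫ x in closedBall x₀ ρ, u x ^ p < e →
      ρ ^ n * u x₀ ^ p ≤ K * ∫ x in closedBall x₀ ρ, u x ^ p := by
  obtain ⟨K₁, hK₁, hloc⟩ := exists_rpow_mul_le_integral n hn hp
  have hn' : (0 : ℝ) < n := by exact_mod_cast hn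
  have hp0 : 0 < p := by linarith
  have hq0 : 0 < q := by rw [hq]; positivity
  set L : ℝ := 2 ^ ((n : ℝ) / p) with hL
  have hL0 : 0 < L := by positivity
  have hLp : L ^ p = 2 ^ n := by
    rw [hL, ← Real.rpow_mul (by norm_num), div_mul_cancel₀ _ hp0.ne', Real.rpow_natCast]
  set η : ℝ := √(1 / (2 * C0 * L ^ q)) with hη
  have hη0 : 0 < η := Real.sqrt_pos.2 (by positivity)
  have hη2 : C0 * L ^ q * η ^ 2 = 1 / 2 := by
    rw [hη, Real.sq_sqrt (by positivity)]
    have : 0 < L ^ q := by positivity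
    field_simp
  refine ⟨2 ^ n * K₁, η ^ n / K₁, by positivity, by positivity, ?_⟩
  intro Ω u hu0 hu hweak x₀ ρ hρ hsub hI
  set I := ∫ x in closedBall x₀ ρ, u x ^ p with hI_def
  have hsubΩ := hsub.trans interior_subset
  have huc : ContinuousOn (fun x => u x ^ p) (closedBall x₀ ρ) :=
    (hu.continuousOn.mono hsubΩ).rpow_const fun x hx => Or.inr hp0.le
  have hInn : 0 ≤ I :=
    setIntegral_nonneg measurableSet_closedBall fun x hx => Real.rpow_nonneg (hu0 x (hsubΩ hx)) p
  obtain ⟨x₁, hx₁, hmax⟩ := (isCompact_closedBall x₀ ρ).exists_isMaxOn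
    ⟨x₀, mem_closedBall_self hρ.le⟩
    (f := fun x => (ρ - ‖x - x₀‖) ^ n * u x ^ p)
    ((Continuous.continuousOn (by fun_prop)).mul huc)
  set σ := ρ - ‖x₁ - x₀‖ with hσ
  have hx₁' : ‖x₁ - x₀‖ ≤ ρ := by simpa [dist_eq_norm] using hx₁
  have h0 : ρ ^ n * u x₀ ^ p ≤ σ ^ n * u x₁ ^ p := by
    simpa using hmax (mem_closedBall_self hρ.le)
  refine h0.trans ?_
  set M := u x₁ with hM_def
  have hMnn : 0 ≤ M := hu0 x₁ (hsubΩ hx₁)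
  have hσnn : 0 ≤ σ := sub_nonneg.2 hx₁'
  rcases hMnn.eq_or_lt with hM | hM
  · rw [← hM, Real.zero_rpow hp0.ne', mul_zero]; positivity
  rcases hσnn.eq_or_lt with hσ0 | hσ0
  · rw [← hσ0, zero_pow hn.ne', zero_mul]; positivity
  have hball : ∀ x ∈ closedBall x₁ (σ / 2), x ∈ closedBall x₀ ρ ∧ u x ≤ L * M := by
    intro x hx
    have hx' : ‖x - x₁‖ ≤ σ / 2 := by simpa [dist_eq_norm] using hx
    have htri : ‖x - x₀‖ ≤ ‖x - x₁‖ + ‖x₁ - x₀‖ := norm_sub_le_norm_sub_add_norm_sub _ _ _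
    have hxρ : x ∈ closedBall x₀ ρ := by
      rw [mem_closedBall, dist_eq_norm]; linarith
    refine ⟨hxρ, ?_⟩
    have hux := hu0 x (hsubΩ hxρ)
    have h1 : (ρ - ‖x - x₀‖) ^ n * u x ^ p ≤ σ ^ n * M ^ p := hmax hxρ
    have h2 : (σ / 2) ^ n ≤ (ρ - ‖x - x₀‖) ^ n := by
      gcongr; linarith
    have h3 : (σ / 2) ^ n * u x ^ p ≤ σ ^ n * M ^ p :=
      (mul_le_mul_of_nonneg_right h2 (Real.rpow_nonneg hux p)).trans h1
    rw [← Real.rpow_le_rpow_iff hux (by positivity) hp0, Real.mul_rpow hL0.le hM.le, hLp]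
    rw [div_pow, div_mul_eq_mul_div, div_le_iff₀ (by positivity)] at h3
    exact le_of_mul_le_mul_left (by linarith) (pow_pos hσ0 n)
  have key : ∀ S : ℝ, 0 < S → S ≤ σ / 2 → S ≤ η * M ^ (-p / n) → M ^ p * S ^ n ≤ K₁ * I := by
    intro S hS0 hS1 hS2
    have hsub1 : closedBall x₁ S ⊆ closedBall x₀ ρ := fun x hx =>
      (hball x (closedBall_subset_closedBall hS1 hx)).1
    refine (hloc Ω u _ hu0 hu ((hu.continuousOn.rpow_const fun x hx => Or.inr hq0.le).const_smul C0)
      hweak x₁ S (C0 * (L * M) ^ q) hS0 (hsub1.trans hsub) (fun x hx => ?_) (by positivity) hM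
      ?_).trans ?_
    · obtain ⟨h1, h2⟩ := hball x (closedBall_subset_closedBall hS1 hx)
      exact mul_le_mul_of_nonneg_left (Real.rpow_le_rpow (hu0 x (hsubΩ h1)) h2 hq0.le) hC0.le
    · have h1 : S ^ 2 ≤ (η * M ^ (-p / n)) ^ 2 := by gcongr
      have h2 : M ^ q * (M ^ (-p / n)) ^ 2 = M := by
        rw [← Real.rpow_mul_natCast hM.le, ← Real.rpow_add hM]
        conv_rhs => rw [← Real.rpow_one M]
        congr 1
        rw [hq]; push_cast; field_simp; ring
      calc C0 * (L * M) ^ q * S ^ 2 ≤ C0 * (L * M) ^ q * (η * M ^ (-p / n)) ^ 2 := by gcongr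
        _ = (C0 * L ^ q * η ^ 2) * (M ^ q * (M ^ (-p / n)) ^ 2) := by
          rw [Real.mul_rpow hL0.le hM.le]; ring
        _ = M / 2 := by rw [hη2, h2]; ring
    · refine mul_le_mul_of_nonneg_left ?_ hK₁.le
      refine setIntegral_mono_set (huc.integrableOn_compact (isCompact_closedBall _ _)) ?_
        hsub1.eventuallyLE
      exact (ae_restrict_iff' measurableSet_closedBall).2
        (ae_of_all _ fun x hx => Real.rpow_nonneg (hu0 x (hsubΩ hx)) p)
  rcases le_total (η * M ^ (-p / n)) (σ / 2) with hc | hc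
  · exfalso
    have h1 := key _ (by positivity) hc le_rfl
    have h2 : M ^ p * (η * M ^ (-p / n)) ^ n = η ^ n := by
      rw [mul_pow, ← Real.rpow_mul_natCast hM.le, div_mul_cancel₀ _ hn'.ne', mul_left_comm,
        ← Real.rpow_add hM]
      simp
    rw [h2] at h1
    rw [lt_div_iff₀ hK₁] at hI
    linarith
  · have h1 := key _ (by positivity) le_rfl hc
    rw [div_pow, mul_div_assoc', div_le_iff₀ (by positivity)] at h1
    linarith

end EpsRegularity

section Decay

variable {n : ℕ}

lemma tendsto_setIntegral_compl_ball {f : EuclideanSpace ℝ (Fin n) → ℝ} {r : ℝ}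
    (hf : IntegrableOn f (ball 0 r)ᶜ) :
    Tendsto (fun k : ℕ => ∫ x in (ball 0 r)ᶜ ∩ (ball 0 (k : ℝ))ᶜ, f x) atTop (nhds 0) := by
  have h := tendsto_setIntegral_of_antitone (μ := volume) (f := f)
    (s := fun k : ℕ => (ball (0 : EuclideanSpace ℝ (Fin n)) r)ᶜ ∩ (ball 0 (k : ℝ))ᶜ)
    (fun k => measurableSet_ball.compl.inter measurableSet_ball.compl)
    (fun j k hjk => Set.inter_subset_inter_right _
      (Set.compl_subset_compl.2 (ball_subset_ball (by exact_mod_cast hjk))))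
    ⟨0, hf.mono_set Set.inter_subset_left⟩
  have hempty : ⋂ k : ℕ, (ball (0 : EuclideanSpace ℝ (Fin n)) r)ᶜ ∩ (ball 0 (k : ℝ))ᶜ = ∅ := by
    refine Set.eq_empty_of_forall_notMem fun x hx => ?_
    obtain ⟨k, hk⟩ := exists_nat_gt ‖x‖
    exact (Set.mem_iInter.1 hx k).2 (by simpa using hk)
  simpa [hempty] using h

lemma mem_interior_compl_ball {r : ℝ} {x : EuclideanSpace ℝ (Fin n)} (hx : r < ‖x‖) :
    x ∈ interior (ball (0 : EuclideanSpace ℝ (Fin n)) r)ᶜ := by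
  rw [interior_compl]
  intro h
  have := closure_ball_subset_closedBall h
  rw [mem_closedBall, dist_zero_right] at this
  linarith

lemma exists_forall_rpow_mul_le (hn : 0 < n) {p q C0 : ℝ} (hp : 1 < p)
    (hq : q = (2 * p + n) / n) (hC0 : 0 < C0) {r : ℝ} {u : EuclideanSpace ℝ (Fin n) → ℝ}
    (hu0 : ∀ x ∈ (ball 0 r)ᶜ, 0 ≤ u x) (hu : LocallyLipschitzOn (ball 0 r)ᶜ u)
    (hup : IntegrableOn (fun x => u x ^ p) (ball 0 r)ᶜ)
    (hweak : IsWeakSupersol (ball 0 r)ᶜ u fun x => C0 * u x ^ q) {δ : ℝ} (hδ : 0 < δ) :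
    ∃ R, 1 ≤ R ∧ r < R ∧ ∀ x, R ≤ ‖x‖ → (1 + ‖x‖ ^ 2) ^ ((n : ℝ) / 2) * u x ^ p ≤ δ := by
  obtain ⟨K, e, hK, he, hreg⟩ := exists_pow_mul_rpow_le_integral n hn hp hq hC0
  have h8 : (0 : ℝ) < 8 ^ ((n : ℝ) / 2) := by positivity
  obtain ⟨k, hk⟩ := ((tendsto_setIntegral_compl_ball hup).eventually
    (gt_mem_nhds (lt_min he (by positivity : 0 < δ / (8 ^ ((n : ℝ) / 2) * K))))).exists
  rw [lt_min_iff] at hk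
  refine ⟨max 1 (2 * max (|r| + 1) k), le_max_left _ _, ?_, fun x hx => ?_⟩
  · refine lt_of_lt_of_le ?_ (le_max_right _ _)
    have := le_max_left (|r| + 1) (k : ℝ)
    have := le_abs_self r
    have := abs_nonneg r
    linarith
  have hx1 : 1 ≤ ‖x‖ := (le_max_left _ _).trans hx
  have hx2 : 2 * max (|r| + 1) (k : ℝ) ≤ ‖x‖ := (le_max_right _ _).trans hx
  have hxr : r < ‖x‖ / 2 := by
    have := le_max_left (|r| + 1) (k : ℝ)
    have := le_abs_self r
    linarith
  have hxk : (k : ℝ) ≤ ‖x‖ / 2 := by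
    have := le_max_right (|r| + 1) (k : ℝ)
    linarith
  have hball : ∀ y ∈ closedBall x (‖x‖ / 2), ‖x‖ / 2 ≤ ‖y‖ := by
    intro y hy
    rw [mem_closedBall, dist_comm, dist_eq_norm] at hy
    have := norm_sub_norm_le x y
    linarith
  have hsub : closedBall x (‖x‖ / 2) ⊆ interior (ball 0 r)ᶜ := fun y hy =>
    mem_interior_compl_ball (hxr.trans_le (hball y hy))
  have hsub' : closedBall x (‖x‖ / 2) ⊆ (ball 0 r)ᶜ ∩ (ball 0 (k : ℝ))ᶜ := fun y hy =>
    ⟨interior_subset (hsub hy), by simpa using hxk.trans (hball y hy)⟩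
  have hI : ∫ y in closedBall x (‖x‖ / 2), u y ^ p ≤
      ∫ y in (ball 0 r)ᶜ ∩ (ball 0 (k : ℝ))ᶜ, u y ^ p := by
    refine setIntegral_mono_set (hup.mono_set Set.inter_subset_left) ?_
      hsub'.eventuallyLE
    exact (ae_restrict_iff' (measurableSet_ball.compl.inter measurableSet_ball.compl)).2
      (ae_of_all _ fun y hy => Real.rpow_nonneg (hu0 y hy.1) p)
  have h1 := hreg _ u hu0 hu hweak x (‖x‖ / 2) (by linarith) hsub (hI.trans_lt hk.1)
  have h2 := hI.trans_lt hk.2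
  rw [lt_div_iff₀ (by positivity)] at h2
  have h3 : (1 + ‖x‖ ^ 2) ^ ((n : ℝ) / 2) ≤ 8 ^ ((n : ℝ) / 2) * (‖x‖ / 2) ^ n := by
    calc (1 + ‖x‖ ^ 2) ^ ((n : ℝ) / 2) ≤ (8 * (‖x‖ / 2) ^ 2) ^ ((n : ℝ) / 2) := by
          gcongr
          nlinarith
      _ = _ := by
          rw [Real.mul_rpow (by norm_num) (by positivity), ← Real.rpow_natCast_mul (by positivity),
            ← Real.rpow_natCast]
          congr 2
          push_cast; ring
  have hux : 0 ≤ u x ^ p :=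
    Real.rpow_nonneg (hu0 x (interior_subset (hsub (mem_closedBall_self (by positivity))))) p
  calc (1 + ‖x‖ ^ 2) ^ ((n : ℝ) / 2) * u x ^ p
      ≤ 8 ^ ((n : ℝ) / 2) * (‖x‖ / 2) ^ n * u x ^ p := mul_le_mul_of_nonneg_right h3 hux
    _ = 8 ^ ((n : ℝ) / 2) * ((‖x‖ / 2) ^ n * u x ^ p) := by ring
    _ ≤ 8 ^ ((n : ℝ) / 2) * (K * ∫ y in closedBall x (‖x‖ / 2), u y ^ p) := by gcongr
    _ = (∫ y in closedBall x (‖x‖ / 2), u y ^ p) * (8 ^ ((n : ℝ) / 2) * K) := by ring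
    _ ≤ δ := by
      have := mul_le_mul_of_nonneg_right hI (by positivity : 0 ≤ 8 ^ ((n : ℝ) / 2) * K)
      linarith

lemma exists_forall_rpow_le (hn : 0 < n) {p q C0 : ℝ} (hp : 1 < p)
    (hq : q = (2 * p + n) / n) (hC0 : 0 < C0) {r : ℝ} {u : EuclideanSpace ℝ (Fin n) → ℝ}
    (hu0 : ∀ x ∈ (ball 0 r)ᶜ, 0 ≤ u x) (hu : LocallyLipschitzOn (ball 0 r)ᶜ u)
    (hup : IntegrableOn (fun x => u x ^ p) (ball 0 r)ᶜ)
    (hweak : IsWeakSupersol (ball 0 r)ᶜ u fun x => C0 * u x ^ q) {δ s : ℝ} (hδ : 0 < δ)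
    (hs : 0 < s) :
    ∃ R, 1 ≤ R ∧ r < R ∧ ∀ x, R ≤ ‖x‖ →
      u x ^ s ≤ δ * (1 + ‖x‖ ^ 2) ^ (-(n * s / p) / 2) := by
  have hp0 : 0 < p := by linarith
  obtain ⟨R, hR1, hRr, hR⟩ := exists_forall_rpow_mul_le hn hp hq hC0 hu0 hu hup hweak
    (Real.rpow_pos_of_pos hδ (p / s))
  refine ⟨R, hR1, hRr, fun x hx => ?_⟩
  have hux : 0 ≤ u x := hu0 x (interior_subset (mem_interior_compl_ball (hRr.trans_le hx)))
  have hx0 : 0 < 1 + ‖x‖ ^ 2 := by positivity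
  have hps : p / s * (s / p) = 1 := by field_simp
  have h1 := Real.rpow_le_rpow (by positivity) (hR x hx) (by positivity : 0 ≤ s / p)
  rw [← Real.rpow_mul hδ.le, Real.mul_rpow (by positivity) (by positivity),
    ← Real.rpow_mul hx0.le, ← Real.rpow_mul hux, mul_div_cancel₀ _ hp0.ne',
    hps, Real.rpow_one, mul_comm,
    ← le_div_iff₀ (by positivity), div_eq_mul_inv, ← Real.rpow_neg hx0.le] at h1
  refine h1.trans_eq ?_
  congr 2
  ring

end Decay

section Barrier

variable {n : ℕ}

/-- The barrier `(1 + |x|²)^(-λ/2)`. -/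
def barrier (lam : ℝ) (x : EuclideanSpace ℝ (Fin n)) : ℝ :=
  (1 + ‖x‖ ^ 2) ^ (-lam / 2)

lemma barrier_pos (lam : ℝ) (x : EuclideanSpace ℝ (Fin n)) : 0 < barrier lam x :=
  Real.rpow_pos_of_pos (by positivity) _

lemma contDiff_barrier {k : WithTop ℕ∞} (lam : ℝ) : ContDiff ℝ k (barrier (n := n) lam) :=
  (contDiff_const.add (contDiff_norm_sq ℝ)).rpow_const_of_ne fun x => by positivity

lemma lap_barrier_le {lam : ℝ} (hlam : 0 < lam) (x : EuclideanSpace ℝ (Fin n)) :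
    lap (barrier lam) x ≤ -(lam * (n - 2 - lam)) * (1 + ‖x‖ ^ 2)⁻¹ * barrier lam x := by
  have hder : ∀ e s : ℝ, 0 ≤ s →
      HasDerivAt (fun s => (1 + s) ^ e) (e * (1 + s) ^ (e - 1)) s := fun e s hs => by
    simpa using ((hasDerivAt_id s).const_add 1).rpow_const (p := e) (Or.inl (by simp; positivity))
  have h := lap_radial (g := fun s => (1 + s) ^ (-lam / 2))
    (g' := fun s => -lam / 2 * (1 + s) ^ (-lam / 2 - 1))
    (g'' := fun s => -lam / 2 * ((-lam / 2 - 1) * (1 + s) ^ (-lam / 2 - 1 - 1)))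
    (hder _) (fun s hs => (hder _ s hs).const_mul _) zero_le_one
    (0 : EuclideanSpace ℝ (Fin n)) x
  simp only [sub_zero, one_mul] at h
  have ht : 0 < 1 + ‖x‖ ^ 2 := by positivity
  have hb := barrier_pos lam x
  rw [Real.rpow_sub_one ht.ne', Real.rpow_sub_one ht.ne'] at h
  change lap (barrier lam) x = _ at h
  change _ = 4 * 1 ^ 2 * ‖x‖ ^ 2 *
    (-lam / 2 * ((-lam / 2 - 1) * (barrier lam x / (1 + ‖x‖ ^ 2) / (1 + ‖x‖ ^ 2)))) +
    2 * n * 1 * (-lam / 2 * (barrier lam x / (1 + ‖x‖ ^ 2))) at h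
  have hdiff : -(lam * (n - 2 - lam)) * (1 + ‖x‖ ^ 2)⁻¹ * barrier lam x - lap (barrier lam) x =
      lam * (lam + 2) * barrier lam x / (1 + ‖x‖ ^ 2) ^ 2 := by
    rw [h]; field_simp; ring
  have : 0 ≤ lam * (lam + 2) * barrier lam x / (1 + ‖x‖ ^ 2) ^ 2 := by positivity
  linarith

lemma barrier_le_rpow_norm {lam : ℝ} (hlam : 0 ≤ lam) {x : EuclideanSpace ℝ (Fin n)}
    (hx : 0 < ‖x‖) : barrier lam x ≤ ‖x‖ ^ (-lam) := by
  have h1 : ‖x‖ ^ (-lam) = (‖x‖ ^ 2) ^ (-lam / 2) := by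
    rw [← Real.rpow_natCast_mul hx.le]; congr 1; push_cast; ring
  rw [h1, barrier]
  exact Real.rpow_le_rpow_of_nonpos (by positivity) (by linarith) (by linarith)

/-- Comparison in an exterior domain with a positive function `W` whose multiples cannot
touch `u` from above. -/
lemma le_of_forall_lap_neg (hn : 0 < n) {r R R' : ℝ} (hrR : r < R)
    {u F W : EuclideanSpace ℝ (Fin n) → ℝ} (hu : LocallyLipschitzOn (ball 0 r)ᶜ u)
    (hF : ContinuousOn F (ball 0 r)ᶜ) (hweak : IsWeakSupersol (ball 0 r)ᶜ u F)
    (hW : ContDiff ℝ 2 W) (hW0 : ∀ x, 0 < W x)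
    (hlap : ∀ x, R < ‖x‖ → 0 < u x → F x + u x / W x * lap W x < 0)
    (hin : ∀ x, ‖x‖ = R → u x ≤ W x) (hout : ∀ x, R' ≤ ‖x‖ → u x ≤ W x)
    {x : EuclideanSpace ℝ (Fin n)} (hx : R ≤ ‖x‖) : u x ≤ W x := by
  by_contra! hlt
  have hxR' : ‖x‖ ≤ R' := by
    by_contra! h
    exact hlt.not_ge (hout x h.le)
  have hcomp : IsCompact (closedBall (0 : EuclideanSpace ℝ (Fin n)) R' ∩ (ball 0 R)ᶜ) :=
    (isCompact_closedBall 0 R').inter_right isOpen_ball.isClosed_compl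
  have hsub : closedBall (0 : EuclideanSpace ℝ (Fin n)) R' ∩ (ball 0 R)ᶜ ⊆ (ball 0 r)ᶜ :=
    fun y hy => Set.compl_subset_compl.2 (ball_subset_ball hrR.le) hy.2
  obtain ⟨a, ha, hmax⟩ := hcomp.exists_isMaxOn (f := fun y => u y / W y)
    ⟨x, by simpa using hxR', by simpa using hx⟩
    ((hu.continuousOn.mono hsub).div hW.continuous.continuousOn fun y _ => (hW0 y).ne')
  simp only [Set.mem_inter_iff, mem_closedBall, dist_zero_right, Set.mem_compl_iff, mem_ball,
    not_lt] at ha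
  have hT : 1 < u a / W a :=
    ((one_lt_div (hW0 x)).2 hlt).trans_le (hmax ⟨by simpa using hxR', by simpa using hx⟩)
  have hua : W a < u a := (one_lt_div (hW0 a)).1 hT
  have hRa : R < ‖a‖ := ha.2.lt_of_ne fun h => hua.not_ge (hin a h.symm)
  have haR' : ‖a‖ < R' := ha.1.lt_of_ne fun h => hua.not_ge (hout a h.ge)
  have hnhds : ∀ᶠ y in nhds a, R < ‖y‖ ∧ ‖y‖ < R' :=
    (continuous_norm.continuousAt.eventually (lt_mem_nhds hRa)).and
      (continuous_norm.continuousAt.eventually (gt_mem_nhds haR'))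
  have htouch := nonneg_of_touching hn hu hF hweak (W := fun y => u a / W a * W y)
    (contDiff_const.mul hW) (mem_interior_compl_ball (hrR.trans hRa))
    (hnhds.mono fun y hy => (div_le_iff₀ (hW0 y)).1
      (hmax ⟨by simpa using hy.2.le, by simpa using hy.1.le⟩))
    (div_mul_cancel₀ _ (hW0 a).ne').symm
  rw [lap_const_mul hW] at htouch
  exact (hlap a hRa ((hW0 a).trans hua)).not_ge htouch

end Barrier

section Exterior

variable {n : ℕ}

lemma exists_le_mul_barrier (hn : 3 ≤ n) {p q C0 : ℝ} (hp : (n : ℝ) / ((n : ℝ) - 2) < p)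
    (hq : q = (2 * p + n) / n) (hC0 : 0 < C0) {r : ℝ} {u : EuclideanSpace ℝ (Fin n) → ℝ}
    (hu0 : ∀ x ∈ (ball 0 r)ᶜ, 0 ≤ u x) (hu : LocallyLipschitzOn (ball 0 r)ᶜ u)
    (hup : IntegrableOn (fun x => u x ^ p) (ball 0 r)ᶜ)
    (hweak : IsWeakSupersol (ball 0 r)ᶜ u fun x => C0 * u x ^ q) {lam : ℝ} (hlam : 0 < lam)
    (hlam' : lam < (n : ℝ) - 2) :
    ∃ A R : ℝ, 0 ≤ A ∧ 1 ≤ R ∧ ∀ x, R ≤ ‖x‖ → u x ≤ A * barrier lam x := by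
  have hn0 : 0 < n := by lia
  have hn3 : (3 : ℝ) ≤ n := by exact_mod_cast hn
  have hn2 : (0 : ℝ) < (n : ℝ) - 2 := by linarith
  have hp1 : 1 < p := ((one_lt_div hn2).2 (by linarith)).trans hp
  have hp0 : 0 < p := by linarith
  have hμ0 : 0 < n / p := by positivity
  have hμ1 : n / p < n - 2 := by
    rw [div_lt_iff₀ hn2] at hp
    rw [div_lt_iff₀ hp0]
    linarith
  have hq0 : 0 < q := by rw [hq]; positivity
  have hq1 : q = 1 + 2 * p / n := by rw [hq]; field_simp; ring
  obtain ⟨κ, hκ0, hκ₁, hκ₂⟩ :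
      ∃ κ : ℝ, 0 < κ ∧ κ ≤ lam * (n - 2 - lam) ∧ κ ≤ n / p * (n - 2 - n / p) :=
    ⟨_, lt_min (mul_pos hlam (by linarith)) (mul_pos hμ0 (by linarith)), min_le_left _ _,
      min_le_right _ _⟩
  obtain ⟨R, hR1, hRr, hR⟩ := exists_forall_rpow_le hn0 hp1 hq hC0 hu0 hu hup hweak
    (by positivity : 0 < κ / (2 * C0)) (by positivity : 0 < 2 * p / n)
  have hsphere : sphere (0 : EuclideanSpace ℝ (Fin n)) R ⊆ (ball 0 r)ᶜ := fun y hy => by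
    simp only [mem_sphere, dist_zero_right] at hy
    simpa [hy] using hRr.le
  obtain ⟨A, hA⟩ := (isCompact_sphere (0 : EuclideanSpace ℝ (Fin n)) R).bddAbove_image
    (f := fun y => u y / barrier lam y) ((hu.continuousOn.mono hsphere).div
      (contDiff_barrier (k := 0) lam).continuous.continuousOn fun y _ => (barrier_pos lam y).ne')
  refine ⟨max A 1, R, by positivity, hR1, fun x hx => ?_⟩
  have hδ : ∀ δ : ℝ, 0 < δ → u x ≤ max A 1 * barrier lam x + δ * barrier (n / p) x := by
    intro δ hδ
    obtain ⟨R', -, -, hR'⟩ := exists_forall_rpow_le hn0 hp1 hq hC0 hu0 hu hup hweak hδ one_pos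
    have hA0 : 0 < max A 1 := by positivity
    have hb := barrier_pos (n := n) lam
    have hb' := barrier_pos (n := n) (n / p)
    refine le_of_forall_lap_neg (F := fun x => C0 * u x ^ q)
      (W := fun x => max A 1 * barrier lam x + δ * barrier (n / p) x) (R' := R') hn0 hRr hu
      (continuousOn_const.mul (hu.continuousOn.rpow_const fun x hx => Or.inr hq0.le)) hweak
      ((contDiff_const.mul (contDiff_barrier lam)).add
        (contDiff_const.mul (contDiff_barrier (n / p))))
      (fun y => add_pos (mul_pos hA0 (hb y)) (mul_pos hδ (hb' y)))
      (fun y hy huy => ?_) (fun y hy => ?_) (fun y hy => ?_) hx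
    · rw [lap_add (contDiff_const.mul (contDiff_barrier lam))
        (contDiff_const.mul (contDiff_barrier (n / p))), lap_const_mul (contDiff_barrier lam),
        lap_const_mul (contDiff_barrier (n / p))]
      have hWpos := add_pos (mul_pos hA0 (hb y)) (mul_pos hδ (hb' y))
      set W := max A 1 * barrier lam y + δ * barrier (n / p) y with hW
      set t := (1 + ‖y‖ ^ 2)⁻¹ with ht
      have ht0 : 0 < t := by positivity
      have h1 : lap (barrier lam) y ≤ -κ * t * barrier lam y := by
        refine (lap_barrier_le hlam y).trans ?_
        have := mul_le_mul_of_nonneg_right hκ₁ (mul_pos ht0 (hb y)).le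
        linarith
      have h2 : lap (barrier (n / p)) y ≤ -κ * t * barrier (n / p) y := by
        refine (lap_barrier_le hμ0 y).trans ?_
        have := mul_le_mul_of_nonneg_right hκ₂ (mul_pos ht0 (hb' y)).le
        linarith
      have h3 : max A 1 * lap (barrier lam) y + δ * lap (barrier (n / p)) y ≤ -κ * t * W := by
        have e1 := mul_le_mul_of_nonneg_left h1 hA0.le
        have e2 := mul_le_mul_of_nonneg_left h2 hδ.le
        rw [hW]
        linarith
      have h4 : u y / W * (max A 1 * lap (barrier lam) y + δ * lap (barrier (n / p)) y) ≤
          -κ * t * u y := by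
        refine (mul_le_mul_of_nonneg_left h3 (by positivity)).trans_eq ?_
        field_simp
      have h5 : u y ^ (2 * p / n) ≤ κ / (2 * C0) * t := by
        refine (hR y hy.le).trans_eq ?_
        rw [ht, ← Real.rpow_neg_one]
        congr 2
        field_simp
      have h6 : C0 * u y ^ q ≤ κ / 2 * t * u y := by
        rw [hq1, Real.rpow_add huy, Real.rpow_one]
        calc C0 * (u y * u y ^ (2 * p / n)) ≤ C0 * (u y * (κ / (2 * C0) * t)) := by gcongr
          _ = _ := by field_simp
      have h7 : 0 < κ * t * u y := by positivity
      linarith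
    · have h1 : u y / barrier lam y ≤ A := hA ⟨y, by simpa using hy, rfl⟩
      rw [div_le_iff₀ (hb y)] at h1
      have h2 := mul_le_mul_of_nonneg_right (le_max_left A 1) (hb y).le
      have h3 := mul_pos hδ (hb' y)
      linarith
    · have h1 := hR' y hy
      rw [Real.rpow_one, mul_one] at h1
      have h2 := mul_pos hA0 (hb y)
      simp only [barrier] at h2 ⊢
      linarith
  refine le_of_forall_pos_le_add fun ε hε => ?_
  have hb := barrier_pos (n / p) x
  have := hδ (ε / barrier (n / p) x) (by positivity)
  rwa [div_mul_cancel₀ _ hb.ne'] at this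

end Exterior

/-- **Lemma 2 (almost-optimal exterior decay).** Let `p > n/(n-2)`, `q = (2p+n)/n`,
`C₀ > 0`. There exists `ε > 0` such that any nonnegative locally Lipschitz
`u ∈ Lᵖ(ℝⁿ \ B_r)` with `Δu + C₀ u^q ≥ 0` weakly in `ℝⁿ \ B_r` and
`∫_{ℝⁿ \ B_r} uᵖ < ε` satisfies `u(x) = O(|x|^{-λ})` for every `λ < n - 2`. -/
theorem exterior_decay
    (n : ℕ) (hn : 3 ≤ n) (p q C0 : ℝ) (hp : (n : ℝ) / ((n : ℝ) - 2) < p)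
    (hq : q = (2 * p + n) / n) (hC0 : 0 < C0) :
    ∃ ε > (0 : ℝ), ∀ r : ℝ, 0 < r →
      ∀ u : EuclideanSpace ℝ (Fin n) → ℝ,
      (∀ x ∈ (ball (0 : EuclideanSpace ℝ (Fin n)) r)ᶜ, 0 ≤ u x) →
      LocallyLipschitzOn (ball (0 : EuclideanSpace ℝ (Fin n)) r)ᶜ u →
      IntegrableOn (fun x => u x ^ p) (ball (0 : EuclideanSpace ℝ (Fin n)) r)ᶜ →
      IsWeakSupersol (ball 0 r)ᶜ u (fun x => C0 * u x ^ q) →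
      (∫ x in (ball (0 : EuclideanSpace ℝ (Fin n)) r)ᶜ, u x ^ p) < ε →
      ∀ lam : ℝ, lam < (n : ℝ) - 2 →
        ∃ Clam Rlam : ℝ, ∀ x : EuclideanSpace ℝ (Fin n), Rlam ≤ ‖x‖ →
          u x ≤ Clam * ‖x‖ ^ (-lam) := by
  refine ⟨1, one_pos, fun r _ u hu0 hu hup hweak _ lam hlam => ?_⟩
  have hn2 : (0 : ℝ) < (n : ℝ) - 2 := by
    have : (3 : ℝ) ≤ n := by exact_mod_cast hn
    linarith
  have hmax : 0 < max lam (((n : ℝ) - 2) / 2) := lt_max_of_lt_right (by linarith)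
  obtain ⟨A, R, hA, hR, hle⟩ := exists_le_mul_barrier hn hp hq hC0 hu0 hu hup hweak hmax
    (max_lt hlam (by linarith))
  refine ⟨A, R, fun x hx => (hle x hx).trans ?_⟩
  have hx1 : 1 ≤ ‖x‖ := hR.trans hx
  refine mul_le_mul_of_nonneg_left ((barrier_le_rpow_norm hmax.le (by linarith)).trans ?_) hA
  exact Real.rpow_le_rpow_of_exponent_le hx1 (neg_le_neg (le_max_left _ _))
end
end

section
/- Let n ≥ 3, q > 1, C_0 > 0, and γ = n/(n-2). There exists a constant C = C(n, C_s, C_0) with the following property: if u is a nonnegative locally Lipschitz function on an open set Ω ⊆ ℝ^n satisfying Δu + C_0 u^q ≥ 0 weakly in Ω, then for every s > 1 and every nonnegative Lipschitz function φ with compact support in Ω, (∫ (φ² u^s)^γ dx)^{1/γ} ≤ C ∫ ( (s² C_0 / (2(s-1))) φ² u^{q+s-1} + (1 + s²/(s-1)²) |∇φ|² u^s ) dx. -/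
open MeasureTheory Metric Finset Filter Asymptotics
open scoped RealInnerProductSpace

noncomputable section

section Mollify

open scoped Convolution NNReal Topology
open ContinuousLinearMap

variable {E : Type*} [NormedAddCommGroup E] [NormedSpace ℝ E] [FiniteDimensional ℝ E]
  [MeasurableSpace E] [BorelSpace E] {μ : Measure E} [μ.IsAddHaarMeasure]

lemma LipschitzWith.hasFDerivAt_normed_convolution [HasContDiffBump E]
    (ρ : ContDiffBump (0 : E)) {f : E → ℝ} {K : ℝ≥0} (hf : LipschitzWith K f) (x : E) :
    HasFDerivAt (ρ.normed μ ⋆[lsmul ℝ ℝ, μ] f) ((ρ.normed μ ⋆[lsmul ℝ ℝ, μ] fderiv ℝ f) x) x := by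
  have hρc : Continuous (ρ.normed μ) := ρ.continuous_normed
  have hρi : Integrable (ρ.normed μ) μ := ρ.integrable_normed
  refine (hasFDerivAt_integral_of_dominated_loc_of_lip (μ := μ) (s := Set.univ)
    (F := fun y t => ρ.normed μ t • f (y - t)) (F' := fun t => ρ.normed μ t • fderiv ℝ f (x - t))
    (bound := fun t => ρ.normed μ t * K) (x₀ := x) Filter.univ_mem ?_ ?_ ?_ ?_ ?_ ?_).2
  · exact Eventually.of_forall fun y => (hρc.smul
      (hf.continuous.comp (continuous_const.sub continuous_id))).aestronglyMeasurable
  · exact (hρc.smul (hf.continuous.comp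
      (continuous_const.sub continuous_id))).integrable_of_hasCompactSupport
      (ρ.hasCompactSupport_normed.smul_right)
  · exact (hρc.measurable.smul ((measurable_fderiv ℝ f).comp
      (measurable_const.sub measurable_id))).aestronglyMeasurable
  · refine Eventually.of_forall fun t => LipschitzOnWith.of_dist_le_mul fun y _ z _ => ?_
    have h := hf.dist_le_mul (y - t) (z - t)
    rw [dist_sub_right] at h
    have h0 := ρ.nonneg_normed (μ := μ) t
    rw [Real.coe_nnabs, abs_of_nonneg (mul_nonneg h0 K.coe_nonneg), dist_smul₀, Real.norm_eq_abs,
      abs_of_nonneg h0, mul_assoc]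
    exact mul_le_mul_of_nonneg_left h h0
  · exact hρi.mul_const _
  · have h := (Measure.measurePreserving_sub_left μ x).quasiMeasurePreserving.ae hf.ae_differentiableAt
    filter_upwards [h] with t ht
    have h1 : HasFDerivAt (fun y => f (y - t)) (fderiv ℝ f (x - t)) x :=
      (ht.hasFDerivAt.comp x ((hasFDerivAt_id x).sub_const t)).congr_fderiv (comp_id _)
    exact h1.fun_const_smul _

lemma LipschitzWith.exists_contDiff_approx [HasContDiffBump E]
    {f : E → ℝ} {K : ℝ≥0} (hf : LipschitzWith K f)
    (hf0 : ∀ x, 0 ≤ f x) {δ : ℝ} (hδ : 0 < δ) :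
    ∃ g : ℕ → E → ℝ, (∀ k, ContDiff ℝ (⊤ : ℕ∞) (g k)) ∧
      (∀ k, tsupport (g k) ⊆ cthickening δ (tsupport f)) ∧ (∀ k x, 0 ≤ g k x) ∧
      (∀ k x, ‖fderiv ℝ (g k) x‖ ≤ K) ∧ (∀ k x, |g k x - f x| ≤ K * δ) ∧
      (∀ x, Tendsto (fun k => g k x) atTop (𝓝 (f x))) ∧
      ∀ᵐ x ∂μ, Tendsto (fun k => fderiv ℝ (g k) x) atTop (𝓝 (fderiv ℝ f x)) := by
  have hpos : ∀ k : ℕ, 0 < δ / (k + 1) := fun k => by positivity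
  let ρ : ℕ → ContDiffBump (0 : E) := fun k =>
    ⟨δ / (k + 1) / 2, δ / (k + 1), half_pos (hpos k), half_lt_self (hpos k)⟩
  have hr : ∀ k, (ρ k).rOut ≤ δ := fun k =>
    div_le_self hδ.le (by have : (0 : ℝ) ≤ k := k.cast_nonneg; linarith)
  have hlim : Tendsto (fun k => (ρ k).rOut) atTop (𝓝 0) := by
    have := tendsto_one_div_add_atTop_nhds_zero_nat (𝕜 := ℝ) |>.const_mul δ
    simpa [ρ, div_eq_mul_inv] using this
  have hfd : ∀ k x, fderiv ℝ ((ρ k).normed μ ⋆[lsmul ℝ ℝ, μ] f) x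
      = ((ρ k).normed μ ⋆[lsmul ℝ ℝ, μ] fderiv ℝ f) x := fun k x =>
    (hf.hasFDerivAt_normed_convolution (μ := μ) (ρ k) x).fderiv
  have hbd : ∀ x, ‖fderiv ℝ f x‖ ≤ K := fun x => norm_fderiv_le_of_lipschitz ℝ hf
  have hloc : LocallyIntegrable (fderiv ℝ f) μ :=
    (locallyIntegrable_const (K : ℝ)).mono (measurable_fderiv ℝ f).aestronglyMeasurable
      (Eventually.of_forall fun x => by simpa using hbd x)
  refine ⟨fun k => (ρ k).normed μ ⋆[lsmul ℝ ℝ, μ] f, fun k => ?_, fun k => ?_, fun k x => ?_,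
    fun k x => ?_, fun k x => ?_, fun x => ?_, ?_⟩
  · exact (ρ k).hasCompactSupport_normed.contDiff_convolution_left (n := ⊤) _ (ρ k).contDiff_normed
      hf.continuous.locallyIntegrable
  · refine closure_minimal (fun x hx => ?_) isClosed_cthickening
    by_contra hxn
    refine hx ?_
    have hz : ∀ y ∈ ball x (ρ k).rOut, f y = 0 := fun y hy => by
      by_contra hy0
      refine hxn (thickening_subset_cthickening _ _ (mem_thickening_iff.2
        ⟨y, subset_closure hy0, ?_⟩))
      rw [dist_comm]
      exact (mem_ball.1 hy).trans_le (hr k)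
    have hx0 := hz x (mem_ball_self (ρ k).rOut_pos)
    have := (ρ k).dist_normed_convolution_le (μ := μ) (ε := 0) (x₀ := x)
      hf.continuous.aestronglyMeasurable (fun y hy => by rw [hz y hy, hx0, dist_self])
    rw [hx0] at this
    exact dist_le_zero.1 this
  · exact integral_nonneg fun t => mul_nonneg ((ρ k).nonneg_normed t) (hf0 _)
  · rw [hfd]
    have h := norm_integral_le_of_norm_le (μ := μ)
      (f := fun t => (ρ k).normed μ t • fderiv ℝ f (x - t))
      ((ρ k).integrable_normed.mul_const (K : ℝ)) (Eventually.of_forall fun t => by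
        rw [norm_smul, Real.norm_eq_abs, abs_of_nonneg ((ρ k).nonneg_normed t)]
        exact mul_le_mul_of_nonneg_left (hbd _) ((ρ k).nonneg_normed t))
    rw [integral_mul_const, (ρ k).integral_normed, one_mul] at h
    exact h
  · have := (ρ k).dist_normed_convolution_le (μ := μ) (ε := K * δ) (x₀ := x)
      hf.continuous.aestronglyMeasurable (fun y hy => (hf.dist_le_mul y x).trans
        (mul_le_mul_of_nonneg_left ((mem_ball.1 hy).le.trans (hr k)) K.coe_nonneg))
    rwa [Real.dist_eq] at this
  · exact ContDiffBump.convolution_tendsto_right_of_continuous hlim hf.continuous x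
  · have h := ContDiffBump.ae_convolution_tendsto_right_of_locallyIntegrable (μ := μ) (K := 2) hlim
      (Eventually.of_forall fun k => by simp only [ρ]; linarith) hloc
    simpa only [hfd] using h

end Mollify

section Truncation

open scoped NNReal Topology

lemma norm_le_indicator_const {E : Type*} {S : Set E} {f : E → ℝ} {C : ℝ}
    (h0 : ∀ x, x ∉ S → f x = 0) (hb : ∀ x ∈ S, |f x| ≤ C) (x : E) :
    ‖f x‖ ≤ S.indicator (fun _ => C) x := by
  by_cases hx : x ∈ S
  · simpa [hx] using hb x hx
  · simp [hx, h0 x hx]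

variable {E : Type*} [NormedAddCommGroup E] [MeasurableSpace E] [BorelSpace E] {μ : Measure E}
  [IsFiniteMeasureOnCompacts μ]

lemma IsCompact.integrable_indicator_const {S : Set E} (hS : IsCompact S) (C : ℝ) :
    Integrable (S.indicator fun _ => C) μ :=
  (integrable_indicator_iff hS.isClosed.measurableSet).2
    (integrableOn_const hS.measure_lt_top.ne)

lemma IsCompact.integrable_of_bounded {S : Set E} (hS : IsCompact S) {f : E → ℝ} {C : ℝ}
    (hm : Measurable f) (h0 : ∀ x, x ∉ S → f x = 0) (hb : ∀ x ∈ S, |f x| ≤ C) :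
    Integrable f μ :=
  (hS.integrable_indicator_const C).mono' hm.aestronglyMeasurable
    (Eventually.of_forall (norm_le_indicator_const h0 hb))

lemma IsCompact.tendsto_integral_of_bounded {S : Set E} (hS : IsCompact S) {f : ℕ → E → ℝ}
    {g : E → ℝ} {C : ℝ} (hm : ∀ k, Measurable (f k)) (h0 : ∀ k x, x ∉ S → f k x = 0)
    (hb : ∀ k, ∀ x ∈ S, |f k x| ≤ C) (hlim : ∀ᵐ x ∂μ, Tendsto (fun k => f k x) atTop (𝓝 (g x))) :
    Tendsto (fun k => ∫ x, f k x ∂μ) atTop (𝓝 (∫ x, g x ∂μ)) :=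
  tendsto_integral_of_dominated_convergence _ (fun k => (hm k).aestronglyMeasurable)
    (hS.integrable_indicator_const C)
    (fun k => Eventually.of_forall (norm_le_indicator_const (h0 k) (hb k))) hlim

end Truncation

section Gradient

open scoped NNReal Topology Gradient
open InnerProductSpace

lemma LipschitzWith.exists_pow_mul_rpow {E : Type*} [PseudoEMetricSpace E]
    {f g : E → ℝ} {K L : ℝ≥0} (hf : LipschitzWith K f) (hg : LipschitzWith L g) {B c M : ℝ} (hfB : ∀ x, f x ∈ Set.Icc 0 B) (hc : 0 < c)
    (hgM : ∀ x, g x ∈ Set.Icc c M) (m : ℕ) (p : ℝ) :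
    ∃ N, LipschitzWith N fun x => f x ^ m * g x ^ p := by
  have hG : ContDiffOn ℝ 1 (fun z : ℝ × ℝ => z.1 ^ m * z.2 ^ p)
      (Set.Icc 0 B ×ˢ Set.Icc c M) :=
    (contDiff_fst.pow m).contDiffOn.mul
      (contDiff_snd.contDiffOn.rpow_const_of_ne fun z hz => (hc.trans_le hz.2.1).ne')
  obtain ⟨N, hN⟩ := hG.exists_lipschitzOnWith one_ne_zero
    ((convex_Icc _ _).prod (convex_Icc _ _)) (isCompact_Icc.prod isCompact_Icc)
  have h := hN.comp (lipschitzOnWith_univ.2 (hf.prodMk hg))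
    (fun x _ => Set.mk_mem_prod (hfB x) (hgM x))
  exact ⟨_, lipschitzOnWith_univ.1 h⟩

variable {E : Type*} [NormedAddCommGroup E] [InnerProductSpace ℝ E] [FiniteDimensional ℝ E]

lemma norm_gradient (f : E → ℝ) (x : E) : ‖∇ f x‖ = ‖fderiv ℝ f x‖ :=
  LinearIsometryEquiv.norm_map _ _

lemma LipschitzWith.norm_gradient_le {f : E → ℝ} {K : ℝ≥0} (hf : LipschitzWith K f) (x : E) :
    ‖∇ f x‖ ≤ K :=
  (norm_gradient f x).trans_le (norm_fderiv_le_of_lipschitz ℝ hf)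

lemma gradient_eq_zero_of_notMem_tsupport {f : E → ℝ} {x : E} (hx : x ∉ tsupport f) :
    ∇ f x = 0 := by
  rw [gradient, fderiv_of_notMem_tsupport ℝ hx, map_zero]

lemma HasGradientAt.pow_mul_rpow {f g : E → ℝ} {x a b : E} (hf : HasGradientAt f a x)
    (hg : HasGradientAt g b x) (hx : 0 < g x) (m : ℕ) (p : ℝ) :
    HasGradientAt (fun y => f y ^ m * g y ^ p)
      ((m * f x ^ (m - 1) * g x ^ p) • a + (p * f x ^ m * g x ^ (p - 1)) • b) x := by
  rw [hasGradientAt_iff_hasFDerivAt] at *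
  refine ((hf.pow m).mul (hg.rpow_const (p := p) (Or.inl hx.ne'))).congr_fderiv ?_
  ext y
  simp
  ring

variable [MeasurableSpace E] [BorelSpace E]

lemma measurable_gradient (f : E → ℝ) : Measurable (∇ f) :=
  (toDual ℝ E).symm.continuous.measurable.comp (measurable_fderiv ℝ f)

lemma weak_ineq_of_lipschitz {U F : E → ℝ} {L : ℝ≥0} (hU : LipschitzWith L U)
    (hF : Continuous F) {V : Set E} (hV : IsOpen V)
    (H : ∀ ψ : E → ℝ, ContDiff ℝ (⊤ : ℕ∞) ψ → HasCompactSupport ψ → tsupport ψ ⊆ V →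
      (∀ x, 0 ≤ ψ x) → 0 ≤ ∫ x, (-⟪∇ U x, ∇ ψ x⟫ + F x * ψ x))
    {ψ : E → ℝ} {K : ℝ≥0} (hψ : LipschitzWith K ψ) (hc : HasCompactSupport ψ)
    (hs : tsupport ψ ⊆ V) (h0 : ∀ x, 0 ≤ ψ x) :
    0 ≤ ∫ x, (-⟪∇ U x, ∇ ψ x⟫ + F x * ψ x) := by
  obtain ⟨δ, hδ, hδV⟩ := hc.isCompact.exists_cthickening_subset_open hV hs
  obtain ⟨g, hgs, hgt, hg0, hgK, hgd, hgl, hgf⟩ :=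
    hψ.exists_contDiff_approx (μ := volume) h0 hδ
  have hS : IsCompact (cthickening δ (tsupport ψ)) := hc.isCompact.cthickening
  obtain ⟨B, hB⟩ := hψ.continuous.bounded_above_of_compact_support hc
  obtain ⟨A, hA⟩ := hS.exists_bound_of_continuousOn hF.continuousOn
  have hlim := hS.tendsto_integral_of_bounded (μ := volume) (C := L * K + A * (B + K * δ))
    (f := fun k x => -⟪∇ U x, ∇ (g k) x⟫ + F x * g k x)
    (g := fun x => -⟪∇ U x, ∇ ψ x⟫ + F x * ψ x) (fun k => ?_) (fun k x hx => ?_)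
    (fun k x hx => ?_) ?_
  · refine ge_of_tendsto' hlim fun k => H _ (hgs k) ?_ ((hgt k).trans hδV) (hg0 k)
    exact hS.of_isClosed_subset (isClosed_tsupport _) (hgt k)
  · exact ((measurable_gradient U).inner (measurable_gradient _)).neg.add
      (hF.measurable.mul (hgs k).continuous.measurable)
  · have hx' := fun h => hx (hgt k h)
    simp [gradient_eq_zero_of_notMem_tsupport hx', image_eq_zero_of_notMem_tsupport hx']
  · have h1 : |⟪∇ U x, ∇ (g k) x⟫| ≤ L * K := (abs_real_inner_le_norm _ _).trans
      (mul_le_mul (hU.norm_gradient_le x) ((norm_gradient _ _).trans_le (hgK k x))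
        (norm_nonneg _) L.coe_nonneg)
    have h2 : |g k x| ≤ B + K * δ := by
      have h3 := abs_add_le (ψ x) (g k x - ψ x)
      rw [add_sub_cancel] at h3
      exact h3.trans (add_le_add (hB x) (hgd k x))
    have h4 : |F x * g k x| ≤ A * (B + K * δ) := by
      rw [abs_mul]
      exact mul_le_mul (hA x hx) h2 (abs_nonneg _) ((abs_nonneg _).trans (hA x hx))
    refine (abs_add_le _ _).trans (add_le_add ?_ h4)
    rwa [abs_neg]
  · filter_upwards [hgf] with x hx
    exact (Tendsto.inner tendsto_const_nhds
      (((toDual ℝ E).symm.continuous.tendsto _).comp hx)).neg.add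
      ((hgl x).const_mul _)

end Gradient

lemma norm_add_smul_sq_le {E : Type*} [NormedAddCommGroup E] [InnerProductSpace ℝ E] (X Y : E)
    {s : ℝ} (hs : 1 < s) :
    ‖X + (s / 2) • Y‖ ^ 2 ≤ s ^ 2 / (s - 1) * (2 * ⟪Y, X⟫ + (s - 1) * ‖Y‖ ^ 2)
      + 2 * (1 + s ^ 2 / (s - 1) ^ 2) * ‖X‖ ^ 2 := by
  have hs1 : s - 1 ≠ 0 := by linarith
  obtain ⟨t, ht⟩ : ∃ t, t = s / (s - 1) := ⟨_, rfl⟩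
  have e1 : s ^ 2 / (s - 1) = s * t := by rw [ht]; ring
  have e2 : s ^ 2 / (s - 1) ^ 2 = t ^ 2 := by rw [ht, div_pow]
  have e3 : t * (s - 1) = s := by rw [ht]; field_simp
  have h := sq_nonneg ‖(2 / 3 * (2 * t - 1)) • X + s • Y‖
  rw [norm_add_sq_real, norm_smul, norm_smul, mul_pow, mul_pow, Real.norm_eq_abs,
    Real.norm_eq_abs, sq_abs, sq_abs, real_inner_smul_left, real_inner_smul_right] at h
  rw [e1, e2, norm_add_sq_real, norm_smul, mul_pow, Real.norm_eq_abs, sq_abs,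
    real_inner_smul_right, real_inner_comm X Y, mul_add, ← mul_assoc (s * t), mul_assoc s t,
    mul_assoc s t, ← mul_assoc t, e3]
  have h2 := mul_nonneg (sq_nonneg (t + 1)) (sq_nonneg ‖X‖)
  nlinarith [h, h2]

section Energy

open scoped NNReal Topology Gradient

variable {E : Type*} [NormedAddCommGroup E] [InnerProductSpace ℝ E] [FiniteDimensional ℝ E]

/-- The integrand on the right-hand side of the Caccioppoli–Sobolev inequality, with `u`
replaced by `u + ε` except in the factor `u ^ q`. -/
def caccioppoliIntegrand (q C0 s : ℝ) (u φ : E → ℝ) (ε : ℝ) (x : E) : ℝ :=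
  (s ^ 2 * C0 / (2 * (s - 1))) * φ x ^ 2 * (u x ^ q * (u x + ε) ^ (s - 1))
    + (1 + s ^ 2 / (s - 1) ^ 2) * ‖∇ φ x‖ ^ 2 * (u x + ε) ^ s

lemma norm_gradient_mul_rpow_sq_le {u φ : E → ℝ} {x : E} (hu : DifferentiableAt ℝ u x)
    (hφ : DifferentiableAt ℝ φ x) {ε s : ℝ} (hx : 0 < u x + ε) (hs : 1 < s) (q C0 : ℝ) :
    ‖∇ (fun y => φ y ^ 1 * (u y + ε) ^ (s / 2)) x‖ ^ 2
      + s ^ 2 / (s - 1) * (-⟪∇ u x, ∇ (fun y => φ y ^ 2 * (u y + ε) ^ (s - 1)) x⟫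
        + C0 * u x ^ q * (φ x ^ 2 * (u x + ε) ^ (s - 1)))
      ≤ 2 * caccioppoliIntegrand q C0 s u φ ε x := by
  have hv : HasGradientAt (fun y => u y + ε) (∇ u x) x :=
    hasGradientAt_iff_hasFDerivAt.2 (hu.hasGradientAt.hasFDerivAt.add_const ε)
  rw [(hφ.hasGradientAt.pow_mul_rpow hv hx 1 (s / 2)).gradient,
    (hφ.hasGradientAt.pow_mul_rpow hv hx 2 (s - 1)).gradient]
  have hα : (u x + ε) ^ s = (u x + ε) ^ (s / 2) * (u x + ε) ^ (s / 2) := by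
    rw [← Real.rpow_add hx]; ring_nf
  have hαβ : (u x + ε) ^ (s - 1) = (u x + ε) ^ (s / 2) * (u x + ε) ^ (s / 2 - 1) := by
    rw [← Real.rpow_add hx]; ring_nf
  have hβ : (u x + ε) ^ (s - 1 - 1) = (u x + ε) ^ (s / 2 - 1) * (u x + ε) ^ (s / 2 - 1) := by
    rw [← Real.rpow_add hx]; ring_nf
  have h := norm_add_smul_sq_le ((u x + ε) ^ (s / 2) • ∇ φ x)
    ((φ x * (u x + ε) ^ (s / 2 - 1)) • ∇ u x) hs
  have hs1 : s - 1 ≠ 0 := by linarith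
  rw [smul_smul, norm_smul, norm_smul, mul_pow, mul_pow, Real.norm_eq_abs, Real.norm_eq_abs,
    sq_abs, sq_abs, real_inner_smul_left, real_inner_smul_right] at h
  simp only [caccioppoliIntegrand, inner_add_right, real_inner_smul_right,
    real_inner_self_eq_norm_sq, hα, hαβ, hβ, Nat.cast_one, Nat.cast_ofNat, pow_one, pow_zero,
    Nat.sub_self, Nat.add_one_sub_one, one_mul, mul_assoc] at h ⊢
  have e : s ^ 2 * C0 / (2 * (s - 1)) = s ^ 2 / (s - 1) * C0 / 2 := by field_simp
  rw [e]
  linear_combination h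

lemma caccioppoliIntegrand_eq_zero {u φ : E → ℝ} {x : E} (hx : x ∉ tsupport φ)
    (q C0 s ε : ℝ) : caccioppoliIntegrand q C0 s u φ ε x = 0 := by
  simp [caccioppoliIntegrand, gradient_eq_zero_of_notMem_tsupport hx,
    image_eq_zero_of_notMem_tsupport hx]

lemma abs_caccioppoliIntegrand_le {u φ : E → ℝ} {K : ℝ≥0} (hφ : LipschitzWith K φ) {B M : ℝ}
    {x : E} (hB : φ x ∈ Set.Icc 0 B) (hM : u x ∈ Set.Icc 0 M) {q C0 s ε : ℝ} (hq : 1 < q)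
    (hC0 : 0 < C0) (hs : 1 < s) (hε : ε ∈ Set.Icc 0 1) :
    |caccioppoliIntegrand q C0 s u φ ε x| ≤
      (s ^ 2 * C0 / (2 * (s - 1))) * B ^ 2 * (M ^ q * (M + 1) ^ (s - 1))
        + (1 + s ^ 2 / (s - 1) ^ 2) * (K : ℝ) ^ 2 * (M + 1) ^ s := by
  have hs1 : 0 < s - 1 := by linarith
  obtain ⟨h1, h2⟩ := hB
  obtain ⟨h3, h4⟩ := hM
  obtain ⟨h5, h6⟩ := hε
  have h7 := hφ.norm_gradient_le x
  have h8 : 0 ≤ u x + ε := add_nonneg h3 h5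
  have hM0 : 0 ≤ M := h3.trans h4
  have h9 : u x + ε ≤ M + 1 := add_le_add h4 h6
  unfold caccioppoliIntegrand
  rw [abs_of_nonneg (by positivity)]
  gcongr

variable [MeasurableSpace E] [BorelSpace E]

lemma measurable_caccioppoliIntegrand {u φ : E → ℝ} (hu : Measurable u) (hφ : Measurable φ)
    (q C0 s ε : ℝ) : Measurable (caccioppoliIntegrand q C0 s u φ ε) :=
  ((hφ.pow_const 2).const_mul _ |>.mul
      ((hu.pow_const q).mul ((hu.add_const ε).pow_const (s - 1)))).add
    (((measurable_gradient φ).norm.pow_const 2).const_mul _ |>.mul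
      ((hu.add_const ε).pow_const s))

lemma integral_norm_gradient_sq_le {u φ : E → ℝ} {L K : ℝ≥0} (hu : LipschitzWith L u)
    {M : ℝ} (hM : ∀ x, u x ∈ Set.Icc 0 M) {V : Set E} (hV : IsOpen V) {q C0 : ℝ} (hq : 1 < q)
    (hC0 : 0 < C0)
    (H : ∀ ψ : E → ℝ, ContDiff ℝ (⊤ : ℕ∞) ψ → HasCompactSupport ψ → tsupport ψ ⊆ V →
      (∀ x, 0 ≤ ψ x) → 0 ≤ ∫ x, (-⟪∇ u x, ∇ ψ x⟫ + C0 * u x ^ q * ψ x))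
    (hφ : LipschitzWith K φ) (hc : HasCompactSupport φ) (hφV : tsupport φ ⊆ V)
    (h0 : ∀ x, 0 ≤ φ x) {s ε : ℝ} (hs : 1 < s) (hε : ε ∈ Set.Ioc 0 1) :
    ∫ x, ‖∇ (fun y => φ y ^ 1 * (u y + ε) ^ (s / 2)) x‖ ^ 2
      ≤ 2 * ∫ x, caccioppoliIntegrand q C0 s u φ ε x := by
  obtain ⟨B, hB⟩ := hφ.continuous.bounded_above_of_compact_support hc
  have hB' : ∀ x, φ x ∈ Set.Icc 0 B := fun x => ⟨h0 x, (le_abs_self _).trans (hB x)⟩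
  have hv : LipschitzWith L fun x => u x + ε := by
    simpa using hu.add (LipschitzWith.const ε)
  have hvM : ∀ x, u x + ε ∈ Set.Icc ε (M + ε) := fun x =>
    ⟨by linarith [(hM x).1], by linarith [(hM x).2]⟩
  obtain ⟨N₁, hN₁⟩ := hφ.exists_pow_mul_rpow hv hB' hε.1 hvM 1 (s / 2)
  obtain ⟨N₂, hN₂⟩ := hφ.exists_pow_mul_rpow hv hB' hε.1 hvM 2 (s - 1)
  have hsub : ∀ (m : ℕ) (p : ℝ), m ≠ 0 →
      tsupport (fun y => φ y ^ m * (u y + ε) ^ p) ⊆ tsupport φ := fun m p hm =>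
    closure_mono fun x hx hx0 => hx (by simp [hx0, hm])
  have hz : ∀ (m : ℕ) (p : ℝ), m ≠ 0 → ∀ x, x ∉ tsupport φ →
      ∇ (fun y => φ y ^ m * (u y + ε) ^ p) x = 0 := fun m p hm x hx =>
    gradient_eq_zero_of_notMem_tsupport fun h => hx (hsub m p hm h)
  have hS := hc.isCompact
  have hF : Continuous fun x => C0 * u x ^ q :=
    continuous_const.mul (hu.continuous.rpow_const fun x => Or.inr (by linarith))
  have hψ0 : ∀ x, 0 ≤ φ x ^ 2 * (u x + ε) ^ (s - 1) := fun x =>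
    mul_nonneg (sq_nonneg _) (Real.rpow_nonneg (hε.1.le.trans (hvM x).1) _)
  have hweak := weak_ineq_of_lipschitz hu hF hV H hN₂
    (hS.of_isClosed_subset (isClosed_tsupport _) (hsub 2 _ two_ne_zero))
    ((hsub 2 _ two_ne_zero).trans hφV) hψ0
  have hint₁ : Integrable fun x => ‖∇ (fun y => φ y ^ 1 * (u y + ε) ^ (s / 2)) x‖ ^ 2 := by
    refine hS.integrable_of_bounded (C := (N₁ : ℝ) ^ 2) ((measurable_gradient _).norm.pow_const 2)
      (fun x hx => by rw [hz 1 _ one_ne_zero x hx]; simp) fun x _ => ?_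
    rw [abs_of_nonneg (sq_nonneg _)]
    exact pow_le_pow_left₀ (norm_nonneg _) (hN₁.norm_gradient_le x) 2
  have hint₂ : Integrable fun x => -⟪∇ u x, ∇ (fun y => φ y ^ 2 * (u y + ε) ^ (s - 1)) x⟫
      + C0 * u x ^ q * (φ x ^ 2 * (u x + ε) ^ (s - 1)) := by
    refine Integrable.add (Integrable.neg ?_) ?_
    · refine hS.integrable_of_bounded (C := L * N₂)
        ((measurable_gradient _).inner (measurable_gradient _))
        (fun x hx => by rw [hz 2 _ two_ne_zero x hx, inner_zero_right]) fun x _ => ?_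
      exact (abs_real_inner_le_norm _ _).trans (mul_le_mul (hu.norm_gradient_le x)
        (hN₂.norm_gradient_le x) (norm_nonneg _) L.coe_nonneg)
    · refine (hF.mul hN₂.continuous).integrable_of_hasCompactSupport ?_
      exact HasCompactSupport.mul_left
        (hS.of_isClosed_subset (isClosed_tsupport _) (hsub 2 _ two_ne_zero))
  have hint₃ : Integrable (caccioppoliIntegrand q C0 s u φ ε) :=
    hS.integrable_of_bounded (measurable_caccioppoliIntegrand hu.continuous.measurable
      hφ.continuous.measurable _ _ _ _) (fun x hx => caccioppoliIntegrand_eq_zero hx _ _ _ _)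
      (fun x _ => abs_caccioppoliIntegrand_le hφ (hB' x) (hM x) hq hC0 hs ⟨hε.1.le, hε.2⟩)
  have hc0 : 0 ≤ s ^ 2 / (s - 1) := div_nonneg (sq_nonneg _) (by linarith)
  rw [← integral_const_mul]
  refine (le_add_of_nonneg_right (mul_nonneg hc0 hweak)).trans ?_
  rw [← integral_const_mul, ← integral_add hint₁ (hint₂.const_mul _)]
  refine integral_mono_ae (hint₁.add (hint₂.const_mul _)) (hint₃.const_mul _) ?_
  filter_upwards [hu.ae_differentiableAt, hφ.ae_differentiableAt] with x hxu hxφ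
  exact norm_gradient_mul_rpow_sq_le hxu hxφ (hε.1.trans_le (hvM x).1) hs q C0

end Energy

section Sobolev

open scoped NNReal Topology Gradient

variable {n : ℕ} {u φ : EuclideanSpace ℝ (Fin n) → ℝ} {L K : ℝ≥0} {M q C0 Cs s : ℝ}
  {V : Set (EuclideanSpace ℝ (Fin n))}

lemma sobolev_caccioppoli_regularized (hCs : SobolevIneq n Cs) (hu : LipschitzWith L u)
    (hM : ∀ x, u x ∈ Set.Icc 0 M) (hV : IsOpen V) (hq : 1 < q) (hC0 : 0 < C0)
    (H : ∀ ψ : EuclideanSpace ℝ (Fin n) → ℝ, ContDiff ℝ (⊤ : ℕ∞) ψ → HasCompactSupport ψ →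
      tsupport ψ ⊆ V → (∀ x, 0 ≤ ψ x) → 0 ≤ ∫ x, (-⟪∇ u x, ∇ ψ x⟫ + C0 * u x ^ q * ψ x))
    (hφ : LipschitzWith K φ) (hc : HasCompactSupport φ) (hφV : tsupport φ ⊆ V)
    (h0 : ∀ x, 0 ≤ φ x) (hs : 1 < s) {ε : ℝ} (hε : ε ∈ Set.Ioc 0 1) :
    (∫ x, (φ x ^ 2 * (u x + ε) ^ s) ^ ((n : ℝ) / ((n : ℝ) - 2))) ^ (((n : ℝ) - 2) / (n : ℝ))
      ≤ 2 * max Cs 1 * ∫ x, caccioppoliIntegrand q C0 s u φ ε x := by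
  obtain ⟨B, hB⟩ := hφ.continuous.bounded_above_of_compact_support hc
  have hv : LipschitzWith L fun x => u x + ε := by
    simpa using hu.add (LipschitzWith.const ε)
  have hv0 : ∀ x, 0 < u x + ε := fun x => add_pos_of_nonneg_of_pos (hM x).1 hε.1
  have hw := hφ.exists_pow_mul_rpow hv (fun x => ⟨h0 x, (le_abs_self _).trans (hB x)⟩) hε.1
    (M := M + ε) (fun x => ⟨by linarith [(hM x).1], by linarith [(hM x).2]⟩) 1 (s / 2)
  have hsob := hCs _ hw (hc.of_isClosed_subset (isClosed_tsupport _)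
    (closure_mono fun x hx hx0 => hx (by simp [hx0])))
  have hpow : ∀ x, |φ x ^ 1 * (u x + ε) ^ (s / 2)| ^ ((2 * (n : ℝ)) / ((n : ℝ) - 2))
      = (φ x ^ 2 * (u x + ε) ^ s) ^ ((n : ℝ) / ((n : ℝ) - 2)) := fun x => by
    have hx : 0 ≤ φ x * (u x + ε) ^ (s / 2) := mul_nonneg (h0 x) (Real.rpow_nonneg (hv0 x).le _)
    rw [pow_one, abs_of_nonneg hx, mul_div_assoc, Real.rpow_mul hx, Real.rpow_two, mul_pow,
      ← Real.rpow_mul_natCast (hv0 x).le]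
    norm_num
  simp only [hpow] at hsob
  have hE := integral_norm_gradient_sq_le hu hM hV hq hC0 H hφ hc hφV h0 hs hε
  calc _ ≤ _ := hsob
    _ ≤ max Cs 1 * ∫ x, ‖∇ (fun y => φ y ^ 1 * (u y + ε) ^ (s / 2)) x‖ ^ 2 :=
      mul_le_mul_of_nonneg_right (le_max_left _ _) (integral_nonneg fun x => sq_nonneg _)
    _ ≤ max Cs 1 * (2 * ∫ x, caccioppoliIntegrand q C0 s u φ ε x) :=
      mul_le_mul_of_nonneg_left hE (zero_le_one.trans (le_max_right _ _))
    _ = _ := by ring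

lemma sobolev_caccioppoli_of_lipschitz (hn : 3 ≤ n) (hCs : SobolevIneq n Cs)
    (hu : LipschitzWith L u)
    (hM : ∀ x, u x ∈ Set.Icc 0 M) (hV : IsOpen V) (hq : 1 < q) (hC0 : 0 < C0)
    (H : ∀ ψ : EuclideanSpace ℝ (Fin n) → ℝ, ContDiff ℝ (⊤ : ℕ∞) ψ → HasCompactSupport ψ →
      tsupport ψ ⊆ V → (∀ x, 0 ≤ ψ x) → 0 ≤ ∫ x, (-⟪∇ u x, ∇ ψ x⟫ + C0 * u x ^ q * ψ x))
    (hφ : LipschitzWith K φ) (hc : HasCompactSupport φ) (hφV : tsupport φ ⊆ V)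
    (h0 : ∀ x, 0 ≤ φ x) (hs : 1 < s) :
    (∫ x, (φ x ^ 2 * u x ^ s) ^ ((n : ℝ) / ((n : ℝ) - 2))) ^ (((n : ℝ) - 2) / (n : ℝ))
      ≤ 2 * max Cs 1 * ∫ x, caccioppoliIntegrand q C0 s u φ 0 x := by
  have hn3 : (3 : ℝ) ≤ n := by exact_mod_cast hn
  have hγ : 0 < (n : ℝ) / ((n : ℝ) - 2) := div_pos (by linarith) (by linarith)
  have hγ' : 0 ≤ ((n : ℝ) - 2) / n := div_nonneg (by linarith) (by linarith)
  obtain ⟨B, hB⟩ := hφ.continuous.bounded_above_of_compact_support hc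
  have hB' : ∀ x, φ x ∈ Set.Icc 0 B := fun x => ⟨h0 x, (le_abs_self _).trans (hB x)⟩
  let ε : ℕ → ℝ := fun k => 1 / ((k : ℝ) + 1)
  have hε : ∀ k, ε k ∈ Set.Ioc 0 1 := fun k =>
    ⟨Nat.one_div_pos_of_nat, div_le_one_of_le₀ (by simp) (by positivity)⟩
  have hεlim : ∀ x, Tendsto (fun k => u x + ε k) atTop (𝓝 (u x + 0)) := fun x =>
    tendsto_one_div_add_atTop_nhds_zero_nat.const_add _
  have hpow : ∀ x (p : ℝ), 0 < p → Tendsto (fun k => (u x + ε k) ^ p) atTop (𝓝 ((u x + 0) ^ p)) :=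
    fun x p hp => (hεlim x).rpow_const (Or.inr hp.le)
  have hS := hc.isCompact
  have hum := hu.continuous.measurable
  have hφm := hφ.continuous.measurable
  have hleft := hS.tendsto_integral_of_bounded (μ := volume)
    (f := fun k x => (φ x ^ 2 * (u x + ε k) ^ s) ^ ((n : ℝ) / ((n : ℝ) - 2)))
    (g := fun x => (φ x ^ 2 * (u x + 0) ^ s) ^ ((n : ℝ) / ((n : ℝ) - 2)))
    (C := (B ^ 2 * (M + 1) ^ s) ^ ((n : ℝ) / ((n : ℝ) - 2)))
    (fun k => ((hφm.pow_const 2).mul ((hum.add_const _).pow_const s)).pow_const _)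
    (fun k x hx => by
      simp [image_eq_zero_of_notMem_tsupport hx, Real.zero_rpow hγ.ne'])
    (fun k x _ => by
      obtain ⟨h1, h2⟩ := hB' x
      obtain ⟨h3, h4⟩ := hM x
      obtain ⟨h5, h6⟩ := hε k
      have h7 : 0 ≤ u x + ε k := add_nonneg h3 h5.le
      rw [abs_of_nonneg (by positivity)]
      gcongr)
    (Eventually.of_forall fun x =>
      ((hpow x s (by linarith)).const_mul _).rpow_const (Or.inr hγ.le))
  have hright := hS.tendsto_integral_of_bounded (μ := volume)
    (f := fun k => caccioppoliIntegrand q C0 s u φ (ε k))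
    (g := caccioppoliIntegrand q C0 s u φ 0)
    (fun k => measurable_caccioppoliIntegrand hum hφm _ _ _ _)
    (fun k x hx => caccioppoliIntegrand_eq_zero hx _ _ _ _)
    (fun k x _ => abs_caccioppoliIntegrand_le hφ (hB' x) (hM x) hq hC0 hs
      ⟨(hε k).1.le, (hε k).2⟩)
    (Eventually.of_forall fun x =>
      (((hpow x (s - 1) (by linarith)).const_mul _).const_mul _).add
        ((hpow x s (by linarith)).const_mul _))
  simp only [add_zero] at hleft
  exact le_of_tendsto_of_tendsto' (hleft.rpow_const (Or.inr hγ')) (hright.const_mul _) fun k =>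
    sobolev_caccioppoli_regularized hCs hu hM hV hq hC0 H hφ hc hφV h0 hs (hε k)

lemma LocallyLipschitzOn.exists_lipschitz_Icc_eqOn {X : Type*} [MetricSpace X] {f : X → ℝ}
    {S : Set X} (hS : IsCompact S) (hf : LocallyLipschitzOn S f) (h0 : ∀ x ∈ S, 0 ≤ f x) :
    ∃ (g : X → ℝ) (L : ℝ≥0) (M : ℝ), LipschitzWith L g ∧ (∀ x, g x ∈ Set.Icc 0 M) ∧
      Set.EqOn f g S := by
  obtain ⟨L, hL⟩ := hf.exists_lipschitzOnWith_of_compact hS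
  obtain ⟨g, hg, hfg⟩ := hL.extend_real
  obtain ⟨M, hM⟩ := hS.exists_bound_of_continuousOn hL.continuousOn
  refine ⟨fun x => max (min (g x) (max M 0)) 0, L, max M 0, (hg.min_const _).max_const _,
    fun x => ⟨le_max_right _ _, max_le (min_le_right _ _) (le_max_right _ _)⟩, fun x hx => ?_⟩
  have h1 : f x ≤ max M 0 := (le_abs_self _).trans ((hM x hx).trans (le_max_left _ _))
  simp only [← hfg hx, min_eq_left h1, max_eq_left (h0 x hx)]

end Sobolev

/-- **Caccioppoli–Sobolev inequality (⋆⋆).** Let `q > 1`, `C₀ > 0`, `γ = n/(n-2)`.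
There exists `C = C(n, Cs, C₀)` such that for any nonnegative locally Lipschitz weak
supersolution `u` of `Δu + C₀ u^q ≥ 0` on an open `Ω`, every `s > 1` and every
nonnegative compactly supported Lipschitz `φ` in `Ω`,
`(∫ (φ² uˢ)^γ)^{1/γ} ≤ C ∫ ((s²C₀/(2(s-1))) φ² u^{q+s-1} + (1 + s²/(s-1)²) |∇φ|² uˢ)`. -/
theorem caccioppoli_sobolev
    (n : ℕ) (hn : 3 ≤ n) (q C0 Cs : ℝ) (hq : 1 < q) (hC0 : 0 < C0)
    (hCs : SobolevIneq n Cs) :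
    ∃ C > (0 : ℝ), ∀ Ω : Set (EuclideanSpace ℝ (Fin n)), IsOpen Ω →
      ∀ u : EuclideanSpace ℝ (Fin n) → ℝ,
      (∀ x ∈ Ω, 0 ≤ u x) →
      LocallyLipschitzOn Ω u →
      IsWeakSupersol Ω u (fun x => C0 * u x ^ q) →
      ∀ s : ℝ, 1 < s →
      ∀ φ : EuclideanSpace ℝ (Fin n) → ℝ, (∃ K, LipschitzWith K φ) →
        HasCompactSupport φ → tsupport φ ⊆ Ω → (∀ x, 0 ≤ φ x) →
        (∫ x in Ω, (φ x ^ 2 * u x ^ s) ^ ((n : ℝ) / ((n : ℝ) - 2))) ^ (((n : ℝ) - 2) / (n : ℝ))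
          ≤ C * ∫ x in Ω,
              ((s ^ 2 * C0 / (2 * (s - 1))) * φ x ^ 2 * u x ^ (q + s - 1)
                + (1 + s ^ 2 / (s - 1) ^ 2) * ‖gradient φ x‖ ^ 2 * u x ^ s) := by
  refine ⟨2 * max Cs 1, by positivity, ?_⟩
  rintro Ω hΩ u hu0 huL hweak s hs φ ⟨K, hφ⟩ hc hφΩ h0
  obtain ⟨δ, hδ, hδΩ⟩ := hc.isCompact.exists_cthickening_subset_open hΩ hφΩ
  obtain ⟨U, L, M, hU, hM, huU⟩ := (huL.mono hδΩ).exists_lipschitz_Icc_eqOn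
    hc.isCompact.cthickening fun x hx => hu0 x (hδΩ hx)
  have hVS : thickening δ (tsupport φ) ⊆ cthickening δ (tsupport φ) :=
    thickening_subset_cthickening _ _
  have hφV : tsupport φ ⊆ thickening δ (tsupport φ) := self_subset_thickening hδ _
  have huV : Set.EqOn u U (thickening δ (tsupport φ)) := huU.mono hVS
  have hgrad : ∀ x ∈ thickening δ (tsupport φ), gradient u x = gradient U x := fun x hx => by
    have h := huV.eventuallyEq_of_mem (isOpen_thickening.mem_nhds hx)
    rw [gradient, gradient, h.fderiv_eq]
  have H : ∀ ψ : EuclideanSpace ℝ (Fin n) → ℝ, ContDiff ℝ (⊤ : ℕ∞) ψ → HasCompactSupport ψ →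
      tsupport ψ ⊆ thickening δ (tsupport φ) → (∀ x, 0 ≤ ψ x) →
      0 ≤ ∫ x, (-⟪gradient U x, gradient ψ x⟫ + C0 * U x ^ q * ψ x) := by
    intro ψ hψ hψc hψV hψ0
    have hψΩ : tsupport ψ ⊆ Ω := hψV.trans (hVS.trans hδΩ)
    refine (hweak ψ hψ hψc (hψΩ.trans hΩ.interior_eq.ge) hψ0).trans_eq ?_
    rw [setIntegral_eq_integral_of_forall_compl_eq_zero fun x hx => ?_]
    · refine integral_congr_ae (Eventually.of_forall fun x => ?_)
      by_cases hx : x ∈ tsupport ψ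
      · simp only [hgrad x (hψV hx), huV (hψV hx)]
      · simp [gradient_eq_zero_of_notMem_tsupport hx, image_eq_zero_of_notMem_tsupport hx]
    · have hx' := fun h => hx (hψΩ h)
      simp [gradient_eq_zero_of_notMem_tsupport hx', image_eq_zero_of_notMem_tsupport hx']
  have hmain := sobolev_caccioppoli_of_lipschitz hn hCs hU hM isOpen_thickening hq hC0 H hφ hc
    hφV h0 hs
  have hn3 : (3 : ℝ) ≤ n := by exact_mod_cast hn
  have hγ : (n : ℝ) / ((n : ℝ) - 2) ≠ 0 := (div_pos (by linarith) (by linarith)).ne'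
  rw [setIntegral_eq_integral_of_forall_compl_eq_zero fun x hx => ?_,
    setIntegral_eq_integral_of_forall_compl_eq_zero fun x hx => ?_]
  · refine (congrArg (· ^ (((n : ℝ) - 2) / (n : ℝ))) ?_).trans_le
      (hmain.trans_eq (congrArg (2 * max Cs 1 * ·) ?_))
    · refine integral_congr_ae (Eventually.of_forall fun x => ?_)
      by_cases hx : x ∈ tsupport φ
      · simp only [huV (hφV hx)]
      · simp [image_eq_zero_of_notMem_tsupport hx]
    · refine integral_congr_ae (Eventually.of_forall fun x => ?_)
      by_cases hx : x ∈ tsupport φ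
      · simp only [caccioppoliIntegrand, add_zero, huV (hφV hx), add_sub_assoc q s 1,
          Real.rpow_add_of_nonneg (hM x).1 (zero_le_one.trans hq.le) (sub_nonneg.2 hs.le)]
      · simp [caccioppoliIntegrand, gradient_eq_zero_of_notMem_tsupport hx,
          image_eq_zero_of_notMem_tsupport hx]
  · have hx' := fun h => hx (hφΩ h)
    simp [gradient_eq_zero_of_notMem_tsupport hx', image_eq_zero_of_notMem_tsupport hx']
  · simp [image_eq_zero_of_notMem_tsupport fun h => hx (hφΩ h), Real.zero_rpow hγ]
end
end
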